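/- arXiv:1706.08290 — 3 statements merged into one kernel-verified Lean document; each statement's English description precedes it below -/
import Mathlib

section
/- Let p ≥ 13 be a prime and let S = PSL(2, p) be the projective special linear group of 2×2 matrices over the field with p elements. Then β(S) ≤ (p + 1) · p · ((p − 1)/2)^{0.9}, and consequently β(S) < |S|^{39/40}. -/
/-!  Definition of the Noether number `β(G)` of a group `G`, over the field `ℂ`
(of characteristic 0).  A finite-dimensional `ℂG`-module is (up to isomorphism)
given by a representation `ρ : Representation ℂ G (Fin n → ℂ)`; the algebra of
polynomial invariants is realised inside `MvPolynomial (Fin n) ℂ` as the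
common equalizer of the substitution maps induced by the group elements. -/

/-- The algebra endomorphism of the polynomial ring induced by the linear action of
`g : G` on the underlying space (substitution of the variables by linear forms). -/
noncomputable def Representation.polySubst {G : Type*} [Group G] {n : ℕ}
    (ρ : Representation ℂ G (Fin n → ℂ)) (g : G) :
    MvPolynomial (Fin n) ℂ →ₐ[ℂ] MvPolynomial (Fin n) ℂ :=
  MvPolynomial.aeval fun i =>
    ∑ j, MvPolynomial.C (LinearMap.toMatrix' (ρ g) i j) * MvPolynomial.X j

/-- The subalgebra of `G`-invariant polynomials. -/
noncomputable def Representation.invariantAlgebra {G : Type*} [Group G] {n : ℕ}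
    (ρ : Representation ℂ G (Fin n → ℂ)) : Subalgebra ℂ (MvPolynomial (Fin n) ℂ) :=
  ⨅ g : G, AlgHom.equalizer (ρ.polySubst g) (AlgHom.id ℂ (MvPolynomial (Fin n) ℂ))

/-- The invariant algebra is generated by its elements of (total) degree at most `d`. -/
def Representation.InvariantsGeneratedInDegree {G : Type*} [Group G] {n : ℕ}
    (ρ : Representation ℂ G (Fin n → ℂ)) (d : ℕ) : Prop :=
  Algebra.adjoin ℂ {f : MvPolynomial (Fin n) ℂ | f ∈ ρ.invariantAlgebra ∧ f.totalDegree ≤ d}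
    = ρ.invariantAlgebra

/-- The Noether number `β(G)`: the smallest degree bound `d` such that for every
finite-dimensional `ℂG`-module the algebra of polynomial invariants is generated
by its elements of degree at most `d`.  (Equivalently, the maximum over all
finite-dimensional modules `V` of the minimal generating degree `β(G,V)`.) -/
noncomputable def noetherNumber (G : Type*) [Group G] : ℕ :=
  sInf {d : ℕ | ∀ (n : ℕ) (ρ : Representation ℂ G (Fin n → ℂ)),
    ρ.InvariantsGeneratedInDegree d}

/-- The Noether index `n(G) = |G| / β(G)`, as a real number. -/
noncomputable def noetherIndex (G : Type*) [Group G] : ℝ :=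
  (Nat.card G : ℝ) / (noetherNumber G : ℝ)

namespace NoetherBound

open MvPolynomial

variable {σ : Type*} {G : Type*} [Group G]

/-- The homogeneous invariants of positive degree. -/
def posInv (α : G →* (MvPolynomial σ ℂ →ₐ[ℂ] MvPolynomial σ ℂ)) : Set (MvPolynomial σ ℂ) :=
  {f | (∀ g, α g f = f) ∧ ∃ a, 0 < a ∧ f.IsHomogeneous a}

/-- The span of the products of two homogeneous invariants of positive degree. -/
noncomputable def decomposables (α : G →* (MvPolynomial σ ℂ →ₐ[ℂ] MvPolynomial σ ℂ)) :
    Submodule ℂ (MvPolynomial σ ℂ) :=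
  Submodule.span ℂ {x | ∃ u ∈ posInv α, ∃ v ∈ posInv α, x = u * v}

/-- The action preserves homogeneity. -/
def IsGraded (α : G →* (MvPolynomial σ ℂ →ₐ[ℂ] MvPolynomial σ ℂ)) : Prop :=
  ∀ (g : G) (f : MvPolynomial σ ℂ) (e : ℕ), f.IsHomogeneous e → (α g f).IsHomogeneous e

/-- Homogeneous invariants of degree exceeding `d` are decomposable. -/
def DecomposableAbove (α : G →* (MvPolynomial σ ℂ →ₐ[ℂ] MvPolynomial σ ℂ)) (d : ℕ) : Prop :=
  ∀ (e : ℕ) (f : MvPolynomial σ ℂ), d < e → f.IsHomogeneous e → (∀ g, α g f = f) →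
    f ∈ decomposables α

/-- The transfer map onto the invariants. -/
noncomputable def transfer [Fintype G] (α : G →* (MvPolynomial σ ℂ →ₐ[ℂ] MvPolynomial σ ℂ)) :
    MvPolynomial σ ℂ →ₗ[ℂ] MvPolynomial σ ℂ :=
  ∑ g, (α g).toLinearMap

section transfer

variable [Fintype G] {α : G →* (MvPolynomial σ ℂ →ₐ[ℂ] MvPolynomial σ ℂ)}

lemma transfer_apply (f : MvPolynomial σ ℂ) : transfer α f = ∑ g, α g f := by
  simp [transfer]

lemma map_transfer (h : G) (f : MvPolynomial σ ℂ) : α h (transfer α f) = transfer α f := by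
  simp only [transfer_apply, map_sum]
  refine Fintype.sum_equiv (Equiv.mulLeft h) _ _ fun g => ?_
  simp

lemma transfer_map (h : G) (f : MvPolynomial σ ℂ) : transfer α (α h f) = transfer α f := by
  simp only [transfer_apply]
  refine Fintype.sum_equiv (Equiv.mulRight h) _ _ fun g => ?_
  simp

lemma transfer_mul_of_invariant (f : MvPolynomial σ ℂ) {v : MvPolynomial σ ℂ}
    (hv : ∀ g, α g v = v) : transfer α (f * v) = transfer α f * v := by
  simp [transfer_apply, hv, Finset.sum_mul]

lemma transfer_of_invariant {v : MvPolynomial σ ℂ} (hv : ∀ g, α g v = v) :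
    transfer α v = (Fintype.card G : ℂ) • v := by
  simp [transfer_apply, hv, Nat.cast_smul_eq_nsmul]

lemma transfer_isHomogeneous (hα : IsGraded α) {f : MvPolynomial σ ℂ} {e : ℕ}
    (hf : f.IsHomogeneous e) : (transfer α f).IsHomogeneous e := by
  rw [transfer_apply]
  exact IsHomogeneous.sum _ _ _ fun g _ => hα g f e hf

lemma transfer_mem_posInv (hα : IsGraded α) {f : MvPolynomial σ ℂ}
    (hf : ∃ a, 0 < a ∧ f.IsHomogeneous a) : transfer α f ∈ posInv α := by
  obtain ⟨a, ha, hf⟩ := hf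
  exact ⟨fun g => map_transfer g f, a, ha, transfer_isHomogeneous hα hf⟩

lemma transfer_mul_transfer_mem (hα : IsGraded α) {f v : MvPolynomial σ ℂ}
    (hf : ∃ a, 0 < a ∧ f.IsHomogeneous a) (hv : ∃ a, 0 < a ∧ v.IsHomogeneous a) :
    transfer α (f * transfer α v) ∈ decomposables α := by
  rw [transfer_mul_of_invariant _ fun g => map_transfer g v]
  exact Submodule.subset_span
    ⟨_, transfer_mem_posInv hα hf, _, transfer_mem_posInv hα hv, rfl⟩

lemma mem_of_transfer_mem {E : Submodule ℂ (MvPolynomial σ ℂ)} {f : MvPolynomial σ ℂ}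
    (hf : ∀ g, α g f = f) (h : transfer α f ∈ E) : f ∈ E := by
  rw [transfer_of_invariant hf] at h
  exact (E.smul_mem_iff (by simp)).1 h

end transfer

lemma exists_isHomogeneous_prod {ι : Type*} {s : Finset ι} (hs : s.Nonempty)
    {b : ι → MvPolynomial σ ℂ} (hb : ∀ i ∈ s, ∃ a, 0 < a ∧ (b i).IsHomogeneous a) :
    ∃ a, 0 < a ∧ (∏ i ∈ s, b i).IsHomogeneous a := by
  choose! a ha hh using hb
  refine ⟨∑ i ∈ s, a i, Finset.sum_pos ha hs, IsHomogeneous.prod _ _ _ hh⟩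

/-- If the blocks `b i` are `H`-invariant, then modulo decomposables the transfer of
`r * ∏ b i` is a combination of transfers in which a nonempty set of blocks is moved by
`h * γ i`, where `h * γ i ∉ H` for all `i`. -/
theorem transfer_exchange [Fintype G]
    {α : G →* (MvPolynomial σ ℂ →ₐ[ℂ] MvPolynomial σ ℂ)} (hα : IsGraded α)
    {ι : Type*} [Fintype ι] [DecidableEq ι] [Nonempty ι] (H : Subgroup G) (γ : ι → G)
    {b : ι → MvPolynomial σ ℂ} (hb : ∀ i, ∀ h ∈ H, α h (b i) = b i)
    (hb' : ∀ i, ∃ a, 0 < a ∧ (b i).IsHomogeneous a)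
    {r : MvPolynomial σ ℂ} (hr : ∃ a, 0 < a ∧ r.IsHomogeneous a)
    {E : Submodule ℂ (MvPolynomial σ ℂ)} (hE : decomposables α ≤ E)
    (hbad : ∀ h, (∀ i, h * γ i ∉ H) → ∀ I : Finset ι, I.Nonempty →
      transfer α (r * ((∏ i ∈ I, α (h * γ i) (b i)) * ∏ i ∈ Iᶜ, b i)) ∈ E) :
    transfer α (r * ∏ i, b i) ∈ E := by
  classical
  set T : G → Finset ι → MvPolynomial σ ℂ := fun h I =>
    transfer α (r * ((∏ i ∈ I, α (h * γ i) (b i)) * ∏ i ∈ Iᶜ, b i)) with hT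
  set good : Finset G := Finset.univ.filter fun h => ∃ i, h * γ i ∈ H with hgood
  have hzero : ∀ h ∈ good, ∑ I : Finset ι, (-1 : ℂ) ^ I.card • T h I = 0 := by
    intro h hh
    obtain ⟨i, hi⟩ := (Finset.mem_filter.1 hh).2
    have h0 : ∏ i, (-α (h * γ i) (b i) + b i) = 0 :=
      Finset.prod_eq_zero (Finset.mem_univ i) (by rw [hb i _ hi]; simp)
    rw [Fintype.prod_add] at h0
    have h1 := congrArg (fun x => transfer α (r * x)) h0
    simp only [mul_zero, map_zero, Finset.mul_sum, map_sum] at h1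
    rw [← h1]
    refine Finset.sum_congr rfl fun I _ => ?_
    rw [Finset.prod_neg, hT, ← map_smul]
    congr 1
    rw [smul_eq_C_mul]
    simp only [map_pow, map_neg, map_one]
    ring
  have hall : ∀ I : Finset ι, I.Nonempty → ∑ h, T h I ∈ E := by
    intro I hI
    have : ∑ h, T h I = transfer α ((r * ∏ i ∈ Iᶜ, b i) * transfer α (∏ i ∈ I, α (γ i) (b i))) := by
      rw [transfer_apply (∏ i ∈ I, α (γ i) (b i)), Finset.mul_sum, map_sum]
      refine Finset.sum_congr rfl fun h _ => ?_
      rw [hT, map_prod]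
      simp only [map_mul, AlgHom.mul_apply]
      ring_nf
    rw [this]
    refine hE (transfer_mul_transfer_mem hα ?_ ?_)
    · obtain ⟨a, ha, hr⟩ := hr
      choose c _ hc' using hb'
      exact ⟨a + ∑ i ∈ Iᶜ, c i, by positivity,
        hr.mul (IsHomogeneous.prod _ _ _ fun i _ => hc' i)⟩
    · refine exists_isHomogeneous_prod hI fun i _ => ?_
      obtain ⟨a, ha, h⟩ := hb' i
      exact ⟨a, ha, hα _ _ _ h⟩
  have hsum : ∀ I : Finset ι, I.Nonempty → ∑ h ∈ good, T h I ∈ E := by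
    intro I hI
    have h1 := Finset.sum_filter_add_sum_filter_not Finset.univ (fun h => ∃ i, h * γ i ∈ H)
      (fun h => T h I)
    rw [← eq_sub_iff_add_eq] at h1
    rw [hgood, h1]
    refine E.sub_mem (hall I hI) (E.sum_mem fun h hh => hbad h ?_ I hI)
    simpa using (Finset.mem_filter.1 hh).2
  have hempty : ∀ h, T h ∅ = transfer α (r * ∏ i, b i) := by
    intro h
    simp [hT]
  have htot : ∑ I : Finset ι, (-1 : ℂ) ^ I.card • ∑ h ∈ good, T h I = 0 := by
    simp_rw [Finset.smul_sum]
    rw [Finset.sum_comm]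
    exact Finset.sum_eq_zero hzero
  rw [← Finset.add_sum_erase _ _ (Finset.mem_univ ∅)] at htot
  simp only [Finset.card_empty, pow_zero, one_smul, hempty, Finset.sum_const] at htot
  have hmem : good.card • transfer α (r * ∏ i, b i) ∈ E := by
    rw [eq_neg_of_add_eq_zero_left htot]
    refine E.neg_mem (E.sum_mem fun I hI => E.smul_mem _ (hsum I ?_))
    exact Finset.nonempty_iff_ne_empty.2 (Finset.ne_of_mem_erase hI)
  have hne : good.card ≠ 0 := by
    obtain ⟨i⟩ := ‹Nonempty ι›
    refine Finset.card_ne_zero_of_mem (a := (γ i)⁻¹) ?_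
    simp only [hgood, Finset.mem_filter, Finset.mem_univ, true_and]
    exact ⟨i, by simp [H.one_mem]⟩
  rw [← Nat.cast_smul_eq_nsmul ℂ] at hmem
  exact (E.smul_mem_iff (Nat.cast_ne_zero.2 hne)).1 hmem

end NoetherBound

namespace NoetherBound

open MvPolynomial

variable {σ : Type*} {G : Type*} [Group G]

lemma exists_isHomogeneous_multiset_prod {C : Multiset (MvPolynomial σ ℂ)}
    (hC : ∀ x ∈ C, ∃ a, 0 < a ∧ x.IsHomogeneous a) (h0 : C ≠ 0) :
    ∃ a, 0 < a ∧ C.prod.IsHomogeneous a := by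
  induction C using Multiset.induction_on with
  | empty => exact absurd rfl h0
  | cons x C ih =>
    obtain ⟨a, ha, hx⟩ := hC x (Multiset.mem_cons_self x C)
    by_cases hC0 : C = 0
    · subst hC0
      exact ⟨a, ha, by simpa using hx⟩
    · obtain ⟨c, hc, hh⟩ := ih (fun y hy => hC y (Multiset.mem_cons_of_mem hy)) hC0
      exact ⟨a + c, by positivity, by simpa using hx.mul hh⟩

lemma exists_eq_map_add {β κ : Type*} [Fintype κ] (C : Multiset β) (h : Fintype.card κ ≤ C.card) :
    ∃ (f : κ → β) (R : Multiset β), C = Finset.univ.val.map f + R := by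
  obtain ⟨l, rfl⟩ := Quot.exists_rep C
  change _ ≤ l.length at h
  let e := Fintype.equivFin κ
  refine ⟨fun x => l.get ⟨e x, (e x).2.trans_le h⟩, (l.drop (Fintype.card κ) : List β), ?_⟩
  have h1 : (Finset.univ : Finset κ).val.map (fun x => l.get ⟨e x, (e x).2.trans_le h⟩) =
      ((l.take (Fintype.card κ) : List β) : Multiset β) := by
    have h2 : (Finset.univ : Finset (Fin (Fintype.card κ))).val = Finset.univ.val.map e := by
      rw [← Finset.map_univ_equiv e, Finset.map_val]
      rfl
    have h3 : (l.take (Fintype.card κ) : List β) =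
        List.ofFn fun i : Fin (Fintype.card κ) => l.get ⟨i, i.2.trans_le h⟩ := by
      refine List.ext_getElem (by simp [h]) fun i _ _ => by simp
    rw [h3, ← Fin.univ_val_map, h2, Multiset.map_map]
    rfl
  rw [h1, Multiset.coe_add, List.take_append_drop]
  rfl

/-- A product of more than `[G : H]` positive degree `H`-invariants has decomposable transfer. -/
theorem transfer_prod_mem_of_index_lt [Fintype G]
    {α : G →* (MvPolynomial σ ℂ →ₐ[ℂ] MvPolynomial σ ℂ)} (hα : IsGraded α) (H : Subgroup G)
    {C : Multiset (MvPolynomial σ ℂ)} (hC : ∀ x ∈ C, x ∈ posInv (α.comp H.subtype))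
    (hcard : H.index < C.card) : transfer α C.prod ∈ decomposables α := by
  classical
  let _ : Fintype (G ⧸ H) := Fintype.ofFinite _
  have hidx : H.index = Fintype.card (G ⧸ H) := by
    rw [Subgroup.index, Nat.card_eq_fintype_card]
  obtain ⟨b, R, rfl⟩ := exists_eq_map_add (κ := G ⧸ H) C (by omega)
  have hb : ∀ c, b c ∈ posInv (α.comp H.subtype) := fun c => hC _ (by simp)
  rw [Multiset.prod_add, mul_comm]
  refine transfer_exchange hα H (fun c : G ⧸ H => c.out) (b := b)
    (fun c h hh => (hb c).1 ⟨h, hh⟩) (fun c => (hb c).2) ?_ le_rfl ?_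
  · refine exists_isHomogeneous_multiset_prod (fun x hx => (hC x (by simp [hx])).2) ?_
    rintro rfl
    simp [hidx] at hcard
  · intro h hh
    obtain ⟨k, hk⟩ := QuotientGroup.mk_out_eq_mul H h⁻¹
    refine absurd ?_ (hh (QuotientGroup.mk h⁻¹))
    rw [hk]
    simp

/-- Decomposing a homogeneous decomposable element within its degree. -/
lemma mem_span_mul_of_mem_decomposables
    {α : G →* (MvPolynomial σ ℂ →ₐ[ℂ] MvPolynomial σ ℂ)} {e : ℕ} {f : MvPolynomial σ ℂ}
    (hf : f ∈ decomposables α) (he : f.IsHomogeneous e) :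
    f ∈ Submodule.span ℂ {x | ∃ a b : ℕ, 0 < a ∧ 0 < b ∧ a + b = e ∧
      ∃ u v : MvPolynomial σ ℂ, u.IsHomogeneous a ∧ v.IsHomogeneous b ∧
        (∀ g, α g u = u) ∧ (∀ g, α g v = v) ∧ x = u * v} := by
  rw [← homogeneousComponent_eq_self he]
  clear he
  induction hf using Submodule.span_induction with
  | mem x hx =>
    obtain ⟨u, ⟨hu, a, ha, hua⟩, v, ⟨hv, b, hb, hvb⟩, rfl⟩ := hx
    rw [homogeneousComponent_of_mem (hua.mul hvb)]
    split_ifs with h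
    · exact Submodule.subset_span ⟨a, b, ha, hb, h.symm, u, v, hua, hvb, hu, hv, rfl⟩
    · exact Submodule.zero_mem _
  | zero => simp
  | add x y _ _ hx hy => rw [map_add]; exact Submodule.add_mem _ hx hy
  | smul c x _ hx => rw [map_smul]; exact Submodule.smul_mem _ c hx

/-- Homogeneous invariants are combinations of products of many positive degree invariants. -/
lemma mem_span_prod_of_decomposableAbove
    {α : G →* (MvPolynomial σ ℂ →ₐ[ℂ] MvPolynomial σ ℂ)} {d : ℕ} (h : DecomposableAbove α d)
    (e : ℕ) (he : 0 < e) (f : MvPolynomial σ ℂ) (hf : f.IsHomogeneous e)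
    (hinv : ∀ g, α g f = f) :
    f ∈ Submodule.span ℂ {x | ∃ C : Multiset (MvPolynomial σ ℂ),
      (∀ y ∈ C, y ∈ posInv α) ∧ e ≤ d * C.card ∧ x = C.prod} := by
  induction e using Nat.strong_induction_on generalizing f with
  | _ e ih =>
    by_cases hed : e ≤ d
    · refine Submodule.subset_span ⟨{f}, ?_, by simpa using hed, by simp⟩
      simpa using ⟨hinv, e, he, hf⟩
    · have h1 := mem_span_mul_of_mem_decomposables (h e f (by omega) hf hinv) hf
      refine Submodule.span_le.2 ?_ h1
      rintro x ⟨a, b, ha, hb, hab, u, v, hu, hv, hui, hvi, rfl⟩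
      have hu' := ih a (by omega) ha u hu hui
      have hv' := ih b (by omega) hb v hv hvi
      have := Submodule.mul_mem_mul hu' hv'
      rw [Submodule.span_mul_span] at this
      refine Submodule.span_mono ?_ this
      rintro _ ⟨_, ⟨C, hC, hCe, rfl⟩, _, ⟨C', hC', hCe', rfl⟩, rfl⟩
      refine ⟨C + C', ?_, ?_, by simp⟩
      · intro y hy
        rcases Multiset.mem_add.1 hy with hy | hy
        exacts [hC y hy, hC' y hy]
      · rw [Multiset.card_add, mul_add]
        omega

/-- `β(G, V) ≤ [G : H] β(H, V)`. -/
theorem DecomposableAbove.of_subgroup [Finite G]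
    {α : G →* (MvPolynomial σ ℂ →ₐ[ℂ] MvPolynomial σ ℂ)} (hα : IsGraded α) (H : Subgroup G)
    {d : ℕ} (h : DecomposableAbove (α.comp H.subtype) d) : DecomposableAbove α (H.index * d) := by
  let _ := Fintype.ofFinite G
  intro e f he hf hinv
  refine mem_of_transfer_mem hinv ?_
  have h1 := mem_span_prod_of_decomposableAbove h e (by omega) f hf fun g => hinv g
  have h2 : f ∈ (decomposables α).comap (transfer α) := by
    refine Submodule.span_le.2 ?_ h1
    rintro x ⟨C, hC, hCe, rfl⟩
    refine transfer_prod_mem_of_index_lt hα H hC ?_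
    by_contra! hle
    have := Nat.mul_le_mul_right d hle
    rw [mul_comm C.card] at this
    omega
  exact h2

lemma homogeneousComponent_map {f : MvPolynomial σ ℂ} {φ : MvPolynomial σ ℂ →ₐ[ℂ] MvPolynomial σ ℂ}
    (hφ : ∀ (f : MvPolynomial σ ℂ) (e : ℕ), f.IsHomogeneous e → (φ f).IsHomogeneous e) (e : ℕ) :
    homogeneousComponent e (φ f) = φ (homogeneousComponent e f) := by
  conv_lhs => rw [← sum_homogeneousComponent f]
  simp only [map_sum]
  rw [Finset.sum_congr rfl fun i _ => homogeneousComponent_of_mem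
    (hφ _ i (homogeneousComponent_isHomogeneous i f))]
  rw [Finset.sum_ite_eq]
  split_ifs with h
  · rfl
  · rw [homogeneousComponent_eq_zero, map_zero]
    simpa [Nat.lt_succ_iff] using h

/-- An invariant lies in the subalgebra generated by the invariants of degree at most `d`. -/
theorem mem_adjoin_of_decomposableAbove
    {α : G →* (MvPolynomial σ ℂ →ₐ[ℂ] MvPolynomial σ ℂ)} (hα : IsGraded α) {d : ℕ}
    (h : DecomposableAbove α d) (f : MvPolynomial σ ℂ) (hf : ∀ g, α g f = f) :
    f ∈ Algebra.adjoin ℂ {f : MvPolynomial σ ℂ | (∀ g, α g f = f) ∧ f.totalDegree ≤ d} := by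
  set S := Algebra.adjoin ℂ {f : MvPolynomial σ ℂ | (∀ g, α g f = f) ∧ f.totalDegree ≤ d}
  have key : ∀ (e : ℕ) (f : MvPolynomial σ ℂ), f.IsHomogeneous e → (∀ g, α g f = f) → f ∈ S := by
    intro e
    induction e using Nat.strong_induction_on with
    | _ e ih =>
      intro f hf hinv
      by_cases hed : e ≤ d
      · exact Algebra.subset_adjoin ⟨hinv, hf.totalDegree_le.trans hed⟩
      · have h1 := mem_span_mul_of_mem_decomposables (h e f (by omega) hf hinv) hf
        refine (Submodule.span_le (p := Subalgebra.toSubmodule S)).2 ?_ h1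
        rintro x ⟨a, b, ha, hb, hab, u, v, hu, hv, hui, hvi, rfl⟩
        exact S.mul_mem (ih a (by omega) u hu hui) (ih b (by omega) v hv hvi)
  rw [← sum_homogeneousComponent f]
  refine S.sum_mem fun e _ => key e _ (homogeneousComponent_isHomogeneous e f) fun g => ?_
  rw [← homogeneousComponent_map (hα g), hf]

/-- The left action on polynomials attached to a representation. -/
noncomputable def polyAction {n : ℕ} (ρ : Representation ℂ G (Fin n → ℂ)) :
    G →* (MvPolynomial (Fin n) ℂ →ₐ[ℂ] MvPolynomial (Fin n) ℂ) where
  toFun g := ρ.polySubst g⁻¹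
  map_one' := by
    refine MvPolynomial.algHom_ext fun i => ?_
    simp only [Representation.polySubst, inv_one, map_one, aeval_X, LinearMap.toMatrix'_one,
      Matrix.one_apply, AlgHom.one_apply]
    rw [Finset.sum_eq_single i (fun j _ hj => by rw [if_neg hj.symm]; simp) (by simp)]
    simp
  map_mul' g h := by
    refine MvPolynomial.algHom_ext fun i => ?_
    simp only [Representation.polySubst, mul_inv_rev, map_mul, aeval_X, AlgHom.mul_apply,
      LinearMap.toMatrix'_mul, Matrix.mul_apply, map_sum, algHom_C, Finset.sum_mul, Finset.mul_sum]
    rw [Finset.sum_comm]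
    simp [mul_assoc]

lemma isGraded_polyAction {n : ℕ} (ρ : Representation ℂ G (Fin n → ℂ)) :
    IsGraded (polyAction ρ) := by
  intro g f e hf
  have := hf.aeval (fun i => ∑ j, C (LinearMap.toMatrix' (ρ g⁻¹) i j) * X j) (n := 1)
    fun i => IsHomogeneous.sum _ _ _ fun j _ => isHomogeneous_C_mul_X _ _
  rw [one_mul] at this
  exact this

lemma mem_invariantAlgebra_iff {n : ℕ} (ρ : Representation ℂ G (Fin n → ℂ))
    (f : MvPolynomial (Fin n) ℂ) :
    f ∈ ρ.invariantAlgebra ↔ ∀ g, polyAction ρ g f = f := by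
  simp only [Representation.invariantAlgebra, Algebra.mem_iInf, AlgHom.mem_equalizer,
    AlgHom.id_apply]
  exact ⟨fun h g => h g⁻¹, fun h g => by simpa [polyAction] using h g⁻¹⟩

theorem noetherNumber_le_of_decomposableAbove {d : ℕ}
    (h : ∀ (n : ℕ) (ρ : Representation ℂ G (Fin n → ℂ)), DecomposableAbove (polyAction ρ) d) :
    noetherNumber G ≤ d := by
  refine Nat.sInf_le fun n ρ => ?_
  simp only [Representation.InvariantsGeneratedInDegree]
  refine le_antisymm (Algebra.adjoin_le fun f hf => hf.1) fun f hf => ?_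
  have := mem_adjoin_of_decomposableAbove (isGraded_polyAction ρ) (h n ρ) f
    ((mem_invariantAlgebra_iff ρ f).1 hf)
  simpa only [mem_invariantAlgebra_iff] using this

end NoetherBound

namespace NoetherBound

lemma exists_le_of_le_map {β κ : Type*} (f : β → κ) (t : Multiset κ) :
    ∀ M : Multiset β, t ≤ M.map f → ∃ M₁ M₂, M = M₁ + M₂ ∧ M₁.map f = t := by
  induction t using Multiset.induction_on with
  | empty => exact fun M _ => ⟨0, M, by simp⟩
  | cons a t ih =>
    intro M h
    obtain ⟨b, hb, rfl⟩ := Multiset.mem_map.1 (Multiset.mem_of_le h (Multiset.mem_cons_self a t))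
    obtain ⟨M', rfl⟩ := Multiset.exists_cons_of_mem hb
    rw [Multiset.map_cons, Multiset.cons_le_cons_iff] at h
    obtain ⟨M₁, M₂, rfl, rfl⟩ := ih M' h
    exact ⟨b ::ₘ M₁, M₂, by simp, by simp⟩

open scoped Pointwise in
/-- Cauchy–Davenport for the sums of `j` terms of a multiset whose multiplicities, truncated
at `j`, add up to at least `j * (k + 1)`. -/
lemma exists_finset_sums {p : ℕ} [Fact p.Prime] (k j : ℕ) :
    ∀ m : Multiset (ZMod p), j * (k + 1) ≤ ∑ w, min (m.count w) j →
      ∃ T : Finset (ZMod p), min p (j * k + 1) ≤ T.card ∧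
        ∀ x ∈ T, ∃ t ≤ m, t.card = j ∧ t.sum = x := by
  induction j with
  | zero =>
    intro m _
    exact ⟨{0}, by simp, fun x hx => ⟨0, by simp, by simp, by simp [Finset.mem_singleton.1 hx]⟩⟩
  | succ j ih =>
    intro m hm
    obtain ⟨A, hAcard, hAm, hA⟩ : ∃ A : Finset (ZMod p), A.card = k + 1 ∧ A.val ≤ m ∧
        j * (k + 1) ≤ ∑ w, min ((m - A.val).count w) j := by
      have hle : ∀ A : Finset (ZMod p), (∀ w ∈ A, 1 ≤ m.count w) → A.val ≤ m := by
        intro A hA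
        rw [Multiset.le_iff_subset A.nodup]
        exact fun w hw => Multiset.one_le_count_iff_mem.1 (hA w hw)
      have hcount : ∀ (A : Finset (ZMod p)) w,
          (m - A.val).count w = m.count w - if w ∈ A then 1 else 0 := by
        intro A w
        rw [Multiset.count_sub, Multiset.count_eq_of_nodup A.nodup]
        rfl
      set H := Finset.univ.filter fun w => j + 1 ≤ m.count w with hH
      set S := Finset.univ.filter fun w => 1 ≤ m.count w with hS
      by_cases hc : k + 1 ≤ H.card
      · obtain ⟨A, hAH, hAc⟩ := Finset.exists_subset_card_eq hc
        have hA' : ∀ w ∈ A, j + 1 ≤ m.count w := fun w hw => (Finset.mem_filter.1 (hAH hw)).2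
        refine ⟨A, hAc, hle A fun w hw => by have := hA' w hw; omega, ?_⟩
        calc j * (k + 1) = ∑ w ∈ A, j := by simp [hAc, mul_comm]
          _ ≤ ∑ w ∈ A, min ((m - A.val).count w) j := by
            refine Finset.sum_le_sum fun w hw => ?_
            have := hA' w hw
            rw [hcount, if_pos hw]
            omega
          _ ≤ _ := Finset.sum_le_sum_of_subset (Finset.subset_univ A)
      · have hSc : k + 1 ≤ S.card := by
          have h1 : ∑ w, min (m.count w) (j + 1) ≤ ∑ w, if w ∈ S then j + 1 else 0 := by
            refine Finset.sum_le_sum fun w _ => ?_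
            simp only [hS, Finset.mem_filter, Finset.mem_univ, true_and]
            split_ifs <;> omega
          rw [Finset.sum_ite_mem, Finset.univ_inter, Finset.sum_const, smul_eq_mul,
            mul_comm S.card] at h1
          exact Nat.le_of_mul_le_mul_left (hm.trans h1) (Nat.succ_pos j)
        have hHS : H ⊆ S := by
          intro w hw
          have := (Finset.mem_filter.1 hw).2
          exact Finset.mem_filter.2 ⟨Finset.mem_univ _, by omega⟩
        obtain ⟨A, hHA, hAS, hAc⟩ := Finset.exists_subsuperset_card_eq hHS (by omega) hSc
        have hA' : ∀ w ∈ A, 1 ≤ m.count w := fun w hw => (Finset.mem_filter.1 (hAS hw)).2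
        refine ⟨A, hAc, hle A hA', ?_⟩
        have h1 : ∑ w, min (m.count w) (j + 1) =
            ∑ w, (min ((m - A.val).count w) j + if w ∈ A then 1 else 0) := by
          refine Finset.sum_congr rfl fun w _ => ?_
          rw [hcount]
          split_ifs with hw
          · have := hA' w hw
            omega
          · have : ¬ j + 1 ≤ m.count w := fun h =>
              hw (hHA (Finset.mem_filter.2 ⟨Finset.mem_univ _, h⟩))
            omega
        rw [Finset.sum_add_distrib, Finset.sum_ite_mem, Finset.univ_inter, Finset.sum_const,
          hAc, smul_eq_mul, mul_one] at h1
        rw [h1] at hm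
        linarith
    obtain ⟨T, hT, hTm⟩ := ih (m - A.val) hA
    refine ⟨A + T, ?_, ?_⟩
    · have hp := (Fact.out : p.Prime)
      have h1 : A.Nonempty := Finset.card_pos.1 (by omega)
      have h2 : T.Nonempty := Finset.card_pos.1 (by have := hp.pos; omega)
      have h3 := ZMod.cauchy_davenport hp h1 h2
      have h4 : (j + 1) * k = j * k + k := by ring
      omega
    · intro x hx
      obtain ⟨a, ha, y, hy, rfl⟩ := Finset.mem_add.1 hx
      obtain ⟨t, htm, htc, hts⟩ := hTm y hy
      refine ⟨{a} + t, ?_, by simp [htc, add_comm], by simp [hts]⟩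
      calc {a} + t ≤ A.val + (m - A.val) :=
            add_le_add (Multiset.singleton_le.2 ha) htm
        _ = m := add_tsub_cancel_of_le hAm

/-- A multiset in `ZMod p` with many distinct enough terms has a zero-sum part of size `j`. -/
lemma exists_zero_sum_card {p : ℕ} [Fact p.Prime] {k j : ℕ} (hkj : p ≤ j * k + 1)
    (m : Multiset (ZMod p)) (hm : j * (k + 1) ≤ ∑ w, min (m.count w) j) :
    ∃ t ≤ m, t.card = j ∧ t.sum = 0 := by
  obtain ⟨T, hT, hTm⟩ := exists_finset_sums k j m hm
  have : T = Finset.univ := by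
    rw [← Finset.card_eq_iff_eq_univ, ZMod.card]
    have := Finset.card_le_univ T
    rw [ZMod.card] at this
    omega
  exact hTm 0 (by simp [this])

/-- If no nonempty set of heavy indices is separated from the remaining ones by a gap, then
the total excess over the level `j` is bounded in terms of the number of heavy indices. -/
lemma sum_excess_le_of_no_gap {ι : Type*} [DecidableEq ι] (O : Finset ι) (m : ι → ℕ) (p : ℕ)
    (h : ℕ) : ∀ j : ℕ,
    (∀ F ⊆ O, F.Nonempty → ¬ ∀ a ∈ F, 2 * j + p * (1 + F.card) < 2 * m a ∧
      ∀ g ∈ O \ F, 2 * m g + p * (1 + F.card) < 2 * m a) →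
    (O.filter fun w => j < m w).card = h →
    3 * ∑ w ∈ O, (2 * m w - 2 * j) ≤ p * (h * (h + 1) * (h + 2)) := by
  induction h using Nat.strong_induction_on with
  | _ h ih =>
    intro j hgap hcard
    set F := O.filter fun w => j < m w with hF
    have hsum : ∑ w ∈ O, (2 * m w - 2 * j) = ∑ w ∈ F, (2 * m w - 2 * j) := by
      rw [hF, Finset.sum_filter]
      refine Finset.sum_congr rfl fun w _ => ?_
      split_ifs <;> omega
    rcases F.eq_empty_or_nonempty with hF0 | hF0
    · rw [hsum, hF0]
      simp
    obtain ⟨b, hbF, hbmin⟩ := F.exists_min_image m hF0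
    have hbj : j < m b := (Finset.mem_filter.1 hbF).2
    have hb : 2 * m b ≤ 2 * j + p * (1 + h) := by
      have h1 := hgap F (Finset.filter_subset _ _) hF0
      by_contra! h2
      refine h1 fun a ha => ?_
      have h3 := hbmin a ha
      rw [hcard]
      refine ⟨by omega, fun g hg => ?_⟩
      have h4 : m g ≤ j := by
        by_contra! h5
        rw [Finset.mem_sdiff] at hg
        exact hg.2 (Finset.mem_filter.2 ⟨hg.1, h5⟩)
      omega
    set h' := (O.filter fun w => m b < m w).card with hh'
    have hlt : h' < h := by
      rw [hh', ← hcard]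
      refine Finset.card_lt_card ⟨fun w hw => ?_, fun hsub => ?_⟩
      · rw [Finset.mem_filter] at hw
        exact Finset.mem_filter.2 ⟨hw.1, hbj.trans hw.2⟩
      · have := (Finset.mem_filter.1 (hsub hbF)).2
        omega
    have h1 := ih h' hlt (m b) (fun G hG hG0 hall => hgap G hG hG0 fun a ha =>
      ⟨by have := (hall a ha).1; omega, (hall a ha).2⟩) rfl
    have h2 : ∑ w ∈ F, (2 * m w - 2 * j) ≤
        ∑ w ∈ O, (2 * m w - 2 * m b) + h * (p * (1 + h)) := by
      calc ∑ w ∈ F, (2 * m w - 2 * j) ≤ ∑ w ∈ F, ((2 * m w - 2 * m b) + p * (1 + h)) := by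
            refine Finset.sum_le_sum fun w hw => ?_
            have := hbmin w hw
            omega
        _ = ∑ w ∈ F, (2 * m w - 2 * m b) + h * (p * (1 + h)) := by
            rw [Finset.sum_add_distrib, Finset.sum_const, hcard, smul_eq_mul]
        _ ≤ _ := by
            gcongr
            exact Finset.filter_subset _ _
    obtain ⟨h'', rfl⟩ : ∃ h'', h = h'' + 1 := ⟨h - 1, by omega⟩
    have h3 : p * (h' * (h' + 1) * (h' + 2)) ≤ p * (h'' * (h'' + 1) * (h'' + 2)) := by
      have : h' ≤ h'' := by omega
      gcongr
    rw [hsum]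
    nlinarith

end NoetherBound

namespace NoetherBound

open MvPolynomial

variable {σ : Type*} {G : Type*} [Group G]

/-- A linear form that is a simultaneous eigenvector of weight `w` for the elements `u x`. -/
structure IsEigenform {X W : Type*} [AddCommMonoid W]
    (α : G →* (MvPolynomial σ ℂ →ₐ[ℂ] MvPolynomial σ ℂ)) (u : X → G) (ψ : X → AddChar W ℂ)
    (w : W) (ℓ : MvPolynomial σ ℂ) : Prop where
  isHomogeneous : ℓ.IsHomogeneous 1
  map : ∀ x, α (u x) ℓ = ψ x w • ℓ

section eigenforms

variable {X W : Type*} [AddCommMonoid W] {α : G →* (MvPolynomial σ ℂ →ₐ[ℂ] MvPolynomial σ ℂ)}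
  {u : X → G} {ψ : X → AddChar W ℂ}

lemma map_prod_eigenforms {M : Multiset (W × MvPolynomial σ ℂ)}
    (hM : ∀ y ∈ M, IsEigenform α u ψ y.1 y.2) (x : X) :
    α (u x) (M.map Prod.snd).prod = ψ x (M.map Prod.fst).sum • (M.map Prod.snd).prod := by
  induction M using Multiset.induction_on with
  | empty => simp
  | cons y M ih =>
    have h1 := ih fun z hz => hM z (Multiset.mem_cons_of_mem hz)
    have h2 := (hM y (Multiset.mem_cons_self y M)).map x
    simp only [Multiset.map_cons, Multiset.prod_cons, Multiset.sum_cons, map_mul, h1, h2,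
      AddChar.map_add_eq_mul, smul_mul_smul_comm]

lemma isHomogeneous_prod_eigenforms {M : Multiset (W × MvPolynomial σ ℂ)}
    (hM : ∀ y ∈ M, IsEigenform α u ψ y.1 y.2) :
    (M.map Prod.snd).prod.IsHomogeneous M.card := by
  induction M using Multiset.induction_on with
  | empty => simpa using isHomogeneous_one σ ℂ
  | cons y M ih =>
    have h1 := ih fun z hz => hM z (Multiset.mem_cons_of_mem hz)
    have h2 := (hM y (Multiset.mem_cons_self y M)).isHomogeneous
    simpa [add_comm] using h2.mul h1

lemma mem_span_prod_eigenforms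
    (hdiag : ∀ ℓ : MvPolynomial σ ℂ, ℓ.IsHomogeneous 1 →
      ℓ ∈ Submodule.span ℂ {ℓ | ∃ w, IsEigenform α u ψ w ℓ})
    (e : ℕ) (f : MvPolynomial σ ℂ) (hf : f.IsHomogeneous e) :
    f ∈ Submodule.span ℂ {x | ∃ M : Multiset (W × MvPolynomial σ ℂ),
      (∀ y ∈ M, IsEigenform α u ψ y.1 y.2) ∧ M.card = e ∧ x = (M.map Prod.snd).prod} := by
  have hf' : f ∈ homogeneousSubmodule σ ℂ 1 ^ e := by
    rw [homogeneousSubmodule_one_pow]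
    exact hf
  clear hf
  induction e generalizing f with
  | zero =>
    rw [pow_zero, Submodule.one_eq_span] at hf'
    refine Submodule.span_mono ?_ hf'
    rintro _ rfl
    exact ⟨0, by simp, by simp, by simp⟩
  | succ e ih =>
    rw [pow_succ] at hf'
    have h0 : homogeneousSubmodule σ ℂ 1 ≤
        Submodule.span ℂ {ℓ | ∃ w, IsEigenform α u ψ w ℓ} := fun ℓ hℓ => hdiag ℓ hℓ
    have h1 := mul_le_mul' (show _ ≤ Submodule.span ℂ _ from fun f hf => ih f hf) h0 hf'
    rw [Submodule.span_mul_span] at h1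
    refine Submodule.span_mono ?_ h1
    rintro _ ⟨_, ⟨M, hM, hMe, rfl⟩, ℓ, ⟨w, hw⟩, rfl⟩
    refine ⟨(w, ℓ) ::ₘ M, ?_, by simp [hMe], by simp [mul_comm]⟩
    intro y hy
    rcases Multiset.mem_cons.1 hy with rfl | hy
    exacts [hw, hM y hy]

/-- It suffices to decompose the transfers of zero-sum products of eigenforms. -/
theorem decomposableAbove_of_zero_sum [Fintype G]
    (hdiag : ∀ ℓ : MvPolynomial σ ℂ, ℓ.IsHomogeneous 1 →
      ℓ ∈ Submodule.span ℂ {ℓ | ∃ w, IsEigenform α u ψ w ℓ})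
    (hsep : ∀ w, w ≠ 0 → ∃ x, ψ x w ≠ 1) {d : ℕ}
    (h : ∀ M : Multiset (W × MvPolynomial σ ℂ), (∀ y ∈ M, IsEigenform α u ψ y.1 y.2) →
      (M.map Prod.fst).sum = 0 → d < M.card →
      transfer α (M.map Prod.snd).prod ∈ decomposables α) :
    DecomposableAbove α d := by
  intro e f he hf hinv
  refine mem_of_transfer_mem hinv ?_
  have h1 : f ∈ (decomposables α).comap (transfer α) := by
    refine Submodule.span_le.2 ?_ (mem_span_prod_eigenforms hdiag e f hf)
    rintro x ⟨M, hM, hMe, rfl⟩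
    by_cases h0 : (M.map Prod.fst).sum = 0
    · exact h M hM h0 (by omega)
    · obtain ⟨x, hx⟩ := hsep _ h0
      have h2 := transfer_map (α := α) (u x) (M.map Prod.snd).prod
      rw [map_prod_eigenforms hM, map_smul, ← sub_eq_zero] at h2
      nth_rewrite 2 [← one_smul ℂ (transfer α _)] at h2
      rw [← sub_smul, smul_eq_zero, sub_eq_zero, or_iff_right hx] at h2
      change transfer α _ ∈ decomposables α
      rw [h2]
      exact Submodule.zero_mem _
  exact h1

lemma prod_eigenforms_mem_posInv {H : Subgroup G} (hH : ∀ h ∈ H, ∃ x, u x = h)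
    {M : Multiset (W × MvPolynomial σ ℂ)} (hM : ∀ y ∈ M, IsEigenform α u ψ y.1 y.2)
    (hsum : (M.map Prod.fst).sum = 0) (h0 : M ≠ 0) :
    (M.map Prod.snd).prod ∈ posInv (α.comp H.subtype) := by
  refine ⟨fun g => ?_, M.card, Multiset.card_pos.2 h0, isHomogeneous_prod_eigenforms hM⟩
  obtain ⟨x, hx⟩ := hH g g.2
  rw [MonoidHom.comp_apply, Subgroup.subtype_apply, ← hx, map_prod_eigenforms hM, hsum]
  simp

end eigenforms

section kleinFour

lemma exists_zero_sum_of_four_le_card {m : Multiset (ZMod 2 × ZMod 2)} (hm : 4 ≤ m.card) :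
    ∃ t ≤ m, 0 < t.card ∧ t.card < 4 ∧ t.sum = 0 := by
  by_cases hnd : m.Nodup
  · refine ⟨{0}, Multiset.singleton_le.2 ?_, by simp, by simp, by simp⟩
    have : m.toFinset = Finset.univ := by
      rw [← Finset.card_eq_iff_eq_univ]
      refine le_antisymm (Finset.card_le_univ _) ?_
      rw [Multiset.toFinset_card_of_nodup hnd]
      simpa using hm
    rw [← Multiset.mem_toFinset, this]
    exact Finset.mem_univ _
  · rw [Multiset.nodup_iff_le] at hnd
    push Not at hnd
    obtain ⟨a, ha⟩ := hnd
    exact ⟨_, ha, by simp, by simp, by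
      have h2 : ∀ a : ZMod 2 × ZMod 2, a + a = 0 := by decide
      simpa using h2 a⟩

/-- A group of exponent two generated by two commuting elements has Noether number at most
three. -/
theorem decomposableAbove_three [Finite G]
    {α : G →* (MvPolynomial σ ℂ →ₐ[ℂ] MvPolynomial σ ℂ)} (hα : IsGraded α) {a b : G}
    (ha : a * a = 1) (hb : b * b = 1) (hab : a * b = b * a)
    (hG : ∀ g, g = 1 ∨ g = a ∨ g = b ∨ g = a * b) : DecomposableAbove α 3 := by
  let _ := Fintype.ofFinite G
  set χ : AddChar (ZMod 2) ℂ := ZMod.stdAddChar with hχ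
  have hχ0 : χ 0 = 1 := χ.map_zero_eq_one
  have hχ1 : χ 1 ≠ 1 := by
    intro h
    exact one_ne_zero (ZMod.injective_stdAddChar (h.trans hχ0.symm))
  have hχ11 : χ 1 * χ 1 = 1 := by
    rw [← AddChar.map_add_eq_mul, show (1 + 1 : ZMod 2) = 0 from rfl, hχ0]
  have hχn : χ 1 = -1 := by
    rcases mul_self_eq_one_iff.1 hχ11 with h | h
    exacts [absurd h hχ1, h]
  set u : Bool → G := fun i => if i then a else b with hu
  set ψ : Bool → AddChar (ZMod 2 × ZMod 2) ℂ := fun i =>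
    if i then χ.compAddMonoidHom (AddMonoidHom.fst _ _)
    else χ.compAddMonoidHom (AddMonoidHom.snd _ _) with hψ
  have hψt : ∀ w, ψ true w = χ w.1 := fun w => rfl
  have hψf : ∀ w, ψ false w = χ w.2 := fun w => rfl
  have hinv : ∀ f, α a f = f → α b f = f → ∀ g, α g f = f := by
    intro f h1 h2 g
    rcases hG g with rfl | rfl | rfl | rfl <;> simp [h1, h2]
  refine decomposableAbove_of_zero_sum (u := u) (ψ := ψ) ?_ ?_ ?_
  · intro ℓ hℓ
    have haa : ∀ f, α a (α a f) = f := fun f => by rw [← AlgHom.mul_apply, ← map_mul, ha]; simp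
    have hbb : ∀ f, α b (α b f) = f := fun f => by rw [← AlgHom.mul_apply, ← map_mul, hb]; simp
    have hba : ∀ f, α b (α a f) = α a (α b f) := fun f => by
      rw [← AlgHom.mul_apply, ← map_mul, ← hab]; simp
    have key : ∀ s t : ℂ, (∃ i, s = χ i) → (∃ i, t = χ i) →
        ℓ + s • α a ℓ + t • α b ℓ + (s * t) • α a (α b ℓ) ∈
          Submodule.span ℂ {ℓ | ∃ w, IsEigenform α u ψ w ℓ} := by
      rintro _ _ ⟨i, rfl⟩ ⟨k, rfl⟩
      have hsq : ∀ i : ZMod 2, χ i * χ i = 1 := by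
        intro i
        rw [← AddChar.map_add_eq_mul, show i + i = 0 by revert i; decide, hχ0]
      have hhom : ∀ (c : ℂ) {f : MvPolynomial σ ℂ}, f.IsHomogeneous 1 → (c • f).IsHomogeneous 1 :=
        fun c f hf => (homogeneousSubmodule σ ℂ 1).smul_mem c hf
      refine Submodule.subset_span ⟨(i, k), ?_, ?_⟩
      · exact ((hℓ.add (hhom _ (hα _ _ _ hℓ))).add (hhom _ (hα _ _ _ hℓ))).add
          (hhom _ (hα _ _ _ (hα _ _ _ hℓ)))
      · rintro (_ | _)
        · change α b _ = χ k • _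
          simp only [map_add, map_smul, hbb, hba, smul_add, smul_smul]
          have h1 := hsq k
          rw [mul_left_comm (χ k) (χ i), h1, mul_comm (χ k) (χ i)]
          simp only [mul_one, one_smul]
          abel
        · change α a _ = χ i • _
          simp only [map_add, map_smul, haa, smul_add, smul_smul]
          have h1 := hsq i
          rw [← mul_assoc, h1]
          simp only [one_mul, one_smul]
          abel
    have h1 : ℓ = (1 / 4 : ℂ) • ((ℓ + (1 : ℂ) • α a ℓ + (1 : ℂ) • α b ℓ +
        ((1 : ℂ) * 1) • α a (α b ℓ)) + (ℓ + (1 : ℂ) • α a ℓ + (-1 : ℂ) • α b ℓ +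
        ((1 : ℂ) * -1) • α a (α b ℓ)) + (ℓ + (-1 : ℂ) • α a ℓ + (1 : ℂ) • α b ℓ +
        ((-1 : ℂ) * 1) • α a (α b ℓ)) + (ℓ + (-1 : ℂ) • α a ℓ + (-1 : ℂ) • α b ℓ +
        ((-1 : ℂ) * -1) • α a (α b ℓ))) := by
      module
    rw [h1]
    have e1 : ∃ i, (1 : ℂ) = χ i := ⟨0, hχ0.symm⟩
    have e2 : ∃ i, (-1 : ℂ) = χ i := ⟨1, hχn.symm⟩
    exact Submodule.smul_mem _ _ (Submodule.add_mem _ (Submodule.add_mem _ (Submodule.add_mem _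
      (key _ _ e1 e1) (key _ _ e1 e2)) (key _ _ e2 e1)) (key _ _ e2 e2))
  · rintro ⟨i, k⟩ hik
    by_cases hi : i = 0
    · refine ⟨false, fun h => hik ?_⟩
      have : k = 0 := ZMod.injective_stdAddChar (h.trans hχ0.symm)
      rw [hi, this, Prod.mk_zero_zero]
    · exact ⟨true, fun h => hi (ZMod.injective_stdAddChar (h.trans hχ0.symm))⟩
  · intro M hM hsum hcard
    obtain ⟨t, ht, ht0, ht4, hts⟩ :=
      exists_zero_sum_of_four_le_card (m := M.map Prod.fst) (by rw [Multiset.card_map]; omega)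
    obtain ⟨M₁, M₂, rfl, rfl⟩ := exists_le_of_le_map Prod.fst t M ht
    rw [Multiset.card_map] at ht0 ht4
    rw [Multiset.map_add, Multiset.sum_add, hts, zero_add] at hsum
    rw [Multiset.card_add] at hcard
    have hmem : ∀ M' : Multiset ((ZMod 2 × ZMod 2) × MvPolynomial σ ℂ),
        (∀ y ∈ M', IsEigenform α u ψ y.1 y.2) → (M'.map Prod.fst).sum = 0 → 0 < M'.card →
        (M'.map Prod.snd).prod ∈ posInv α := by
      intro M' hM' hs h0
      refine ⟨hinv _ ?_ ?_, M'.card, h0, isHomogeneous_prod_eigenforms hM'⟩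
      · have h := map_prod_eigenforms hM' true
        rw [hs, AddChar.map_zero_eq_one, one_smul] at h
        exact h
      · have h := map_prod_eigenforms hM' false
        rw [hs, AddChar.map_zero_eq_one, one_smul] at h
        exact h
    have h1 := hmem M₁ (fun y hy => hM y (Multiset.mem_add.2 (.inl hy))) hts ht0
    have h2 := hmem M₂ (fun y hy => hM y (Multiset.mem_add.2 (.inr hy))) hsum (by omega)
    rw [Multiset.map_add, Multiset.prod_add, transfer_mul_of_invariant _ h2.1,
      transfer_of_invariant h1.1, smul_mul_assoc]
    exact Submodule.smul_mem _ _ (Submodule.subset_span ⟨_, h1, _, h2, rfl⟩)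

end kleinFour

end NoetherBound

namespace NoetherBound

open MvPolynomial

lemma exists_eq_sum_add_of_le_map {β κ ι : Type*} (f : β → κ) (F : Finset ι)
    (T : ι → Multiset κ) : ∀ M : Multiset β, ∑ i ∈ F, T i ≤ M.map f →
      ∃ (B : ι → Multiset β) (R : Multiset β), M = ∑ i ∈ F, B i + R ∧
        ∀ i ∈ F, (B i).map f = T i := by
  classical
  induction F using Finset.induction_on with
  | empty => exact fun M _ => ⟨fun _ => 0, M, by simp⟩
  | insert a F ha ih =>
    intro M hM
    rw [Finset.sum_insert ha] at hM
    obtain ⟨M₁, M₂, rfl, hM₁⟩ := exists_le_of_le_map f (T a) M ((Multiset.le_add_right _ _).trans hM)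
    rw [Multiset.map_add, hM₁, Multiset.add_le_add_iff_left] at hM
    obtain ⟨B, R, rfl, hB⟩ := ih M₂ hM
    refine ⟨Function.update B a M₁, R, ?_, ?_⟩
    · rw [Finset.sum_insert ha, Function.update_self, add_assoc]
      congr 2
      exact Finset.sum_congr rfl fun i hi =>
        (Function.update_of_ne (ne_of_mem_of_not_mem hi ha) _ _).symm
    · intro i hi
      rcases Finset.mem_insert.1 hi with rfl | hi
      · rwa [Function.update_self]
      · rw [Function.update_of_ne (ne_of_mem_of_not_mem hi ha)]
        exact hB i hi

lemma map_finset_sum {β κ ι : Type*} (f : β → κ) (s : Finset ι) (B : ι → Multiset β) :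
    (∑ i ∈ s, B i).map f = ∑ i ∈ s, (B i).map f :=
  map_sum (Multiset.mapAddMonoidHom f) B s

/-- Moving `p` units from each point of `I` to a much lighter point `g` decreases the sum of
squares. -/
lemma sum_sq_lt_sum_sq {κ : Type*} [Fintype κ] [DecidableEq κ] {p : ℕ} (hp : 0 < p)
    {n n' : κ → ℕ} {I : Finset κ} (hI : I.Nonempty) {g : κ} (hg : g ∉ I)
    (h : ∀ w, n' w + (if w ∈ I then p else 0) = n w + if w = g then p * I.card else 0)
    (hlt : ∀ a ∈ I, 2 * n g + p * (1 + I.card) < 2 * n a) :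
    ∑ w, n' w ^ 2 < ∑ w, n w ^ 2 := by
  have h1 : ∀ w, (n' w : ℤ) ^ 2 = n w ^ 2 + (if w ∈ I then (p : ℤ) ^ 2 - 2 * p * n w else 0) +
      if w = g then 2 * p * I.card * n g + (p * I.card : ℤ) ^ 2 else 0 := by
    intro w
    have h2 := h w
    by_cases hw : w = g
    · subst hw
      rw [if_neg hg, if_pos rfl] at h2
      rw [if_neg hg, if_pos rfl]
      have h3 : (n' w : ℤ) = n w + p * I.card := by exact_mod_cast h2
      rw [h3]
      ring
    · rw [if_neg hw] at h2 ⊢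
      by_cases hwI : w ∈ I
      · rw [if_pos hwI] at h2 ⊢
        have h3 : (n' w : ℤ) + p = n w := by exact_mod_cast h2
        rw [← h3]
        ring
      · rw [if_neg hwI] at h2 ⊢
        have h3 : (n' w : ℤ) = n w := by exact_mod_cast h2
        rw [h3]
        ring
  have h2 : (∑ w, (n' w : ℤ) ^ 2) = ∑ w, (n w : ℤ) ^ 2 +
      ∑ w ∈ I, ((p : ℤ) ^ 2 - 2 * p * n w) + (2 * p * I.card * n g + (p * I.card : ℤ) ^ 2) := by
    simp_rw [h1]
    rw [Finset.sum_add_distrib, Finset.sum_add_distrib, Finset.sum_ite_mem, Finset.univ_inter,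
      Finset.sum_ite_eq' Finset.univ g, if_pos (Finset.mem_univ g)]
  have h3 : ∑ w ∈ I, ((p : ℤ) ^ 2 - 2 * p * n w) <
      ∑ w ∈ I, ((p : ℤ) ^ 2 - p * (2 * n g + p * (1 + I.card))) := by
    refine Finset.sum_lt_sum_of_nonempty hI fun a ha => ?_
    have h4 : (2 * n g + p * (1 + I.card) : ℤ) < 2 * n a := by exact_mod_cast hlt a ha
    have h5 : (0 : ℤ) < p := by exact_mod_cast hp
    nlinarith
  rw [Finset.sum_const, nsmul_eq_mul] at h3
  have h4 : (∑ w, (n' w : ℤ) ^ 2) < ∑ w, (n w : ℤ) ^ 2 := by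
    rw [h2]
    linarith
  exact_mod_cast h4

variable {σ : Type*} {G : Type*} [Group G]

/-- A metacyclic structure on a group modelled on the image in `PSL(2, p)` of the upper
triangular matrices: `u` parametrizes the unipotent elements and `t` the diagonal ones. -/
structure BorelDatum (p : ℕ) (G : Type*) [Group G] where
  u : Multiplicative (ZMod p) →* G
  t : (ZMod p)ˣ →* G
  u_mul_t : ∀ (x : ZMod p) (a : (ZMod p)ˣ),
    u (.ofAdd x) * t a = t a * u (.ofAdd ((a⁻¹ : (ZMod p)ˣ) ^ 2 * x))
  t_eq_one : ∀ a, a ^ 2 = 1 → t a = 1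
  exists_eq : ∀ g, ∃ a x, g = t a * u (.ofAdd x)

namespace BorelDatum

variable {p : ℕ} [Fact p.Prime] (D : BorelDatum p G)

/-- The linear forms of weight `w` for the unipotent elements. -/
def IsWeightForm (α : G →* (MvPolynomial σ ℂ →ₐ[ℂ] MvPolynomial σ ℂ)) (w : ZMod p)
    (ℓ : MvPolynomial σ ℂ) : Prop :=
  IsEigenform α (fun x => D.u (.ofAdd x)) (fun x => (ZMod.stdAddChar (N := p)).mulShift x) w ℓ

variable {D} {α : G →* (MvPolynomial σ ℂ →ₐ[ℂ] MvPolynomial σ ℂ)}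

lemma exists_u_eq : ∀ h ∈ D.u.range, ∃ x : ZMod p, D.u (.ofAdd x) = h := by
  rintro _ ⟨x, rfl⟩
  exact ⟨x.toAdd, rfl⟩

lemma u_comm (x y : ZMod p) : D.u (.ofAdd x) * D.u (.ofAdd y) = D.u (.ofAdd y) * D.u (.ofAdd x) := by
  rw [← map_mul, mul_comm, map_mul]

lemma IsWeightForm.move (hα : IsGraded α) {w : ZMod p} {ℓ : MvPolynomial σ ℂ}
    (h : D.IsWeightForm α w ℓ) (a : (ZMod p)ˣ) (y : ZMod p) :
    D.IsWeightForm α ((a⁻¹ : (ZMod p)ˣ) ^ 2 * w) (α (D.t a * D.u (.ofAdd y)) ℓ) := by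
  refine ⟨hα _ _ _ h.isHomogeneous, fun x => ?_⟩
  have h1 := h.map ((a⁻¹ : (ZMod p)ˣ) ^ 2 * x)
  simp only [AddChar.mulShift_apply] at h1 ⊢
  rw [← AlgHom.mul_apply, ← map_mul, ← mul_assoc, D.u_mul_t, mul_assoc, u_comm, ← mul_assoc,
    map_mul, AlgHom.mul_apply, h1, map_smul]
  congr 2
  ring

lemma mem_span_isWeightForm (hα : IsGraded α) (ℓ : MvPolynomial σ ℂ) (hℓ : ℓ.IsHomogeneous 1) :
    ℓ ∈ Submodule.span ℂ {ℓ | ∃ w, D.IsWeightForm α w ℓ} := by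
  have hp : (p : ℂ) ≠ 0 := by exact_mod_cast (Fact.out : p.Prime).ne_zero
  set E : ZMod p → MvPolynomial σ ℂ := fun w =>
    ∑ x : ZMod p, ZMod.stdAddChar (-(w * x)) • α (D.u (.ofAdd x)) ℓ with hE
  have h1 : ∀ w, D.IsWeightForm α w (E w) := by
    intro w
    refine ⟨?_, fun y => ?_⟩
    · exact IsHomogeneous.sum _ _ _ fun x _ =>
        (homogeneousSubmodule σ ℂ 1).smul_mem _ (hα _ _ _ hℓ)
    · simp only [hE, map_sum, map_smul, Finset.smul_sum]
      refine Fintype.sum_equiv (Equiv.addLeft y) _ _ fun x => ?_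
      rw [smul_smul, AddChar.mulShift_apply, ← AddChar.map_add_eq_mul, ← AlgHom.mul_apply,
        ← map_mul, ← map_mul, ← ofAdd_add, Equiv.coe_addLeft]
      congr 2
      ring
  have h2 : ∑ w, E w = (p : ℂ) • ℓ := by
    simp only [hE]
    rw [Finset.sum_comm]
    simp_rw [← Finset.sum_smul]
    have h3 : ∀ x : ZMod p, ∑ w : ZMod p, ZMod.stdAddChar (-(w * x)) =
        if x = 0 then (p : ℂ) else 0 := by
      intro x
      have := AddChar.sum_mulShift (-x) (ZMod.isPrimitive_stdAddChar p)
      simpa [ZMod.card] using this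
    simp_rw [h3, ite_smul, zero_smul]
    rw [Finset.sum_ite_eq' Finset.univ (0 : ZMod p), if_pos (Finset.mem_univ _)]
    simp
  have h3 : (p : ℂ) • ℓ ∈ Submodule.span ℂ {ℓ | ∃ w, D.IsWeightForm α w ℓ} := by
    rw [← h2]
    exact Submodule.sum_mem _ fun w _ => Submodule.subset_span ⟨w, h1 w⟩
  exact (Submodule.smul_mem_iff _ hp).1 h3

/-- If some set `F` of weights, all in one class modulo squares, has multiplicities far above
those of the other weights in the class, then the transfer of a product can be rewritten using
products with a smaller sum of squared multiplicities. -/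
theorem transfer_mem_of_gap [Fintype G] (hα : IsGraded α)
    {C : Multiset (MvPolynomial σ ℂ)} (hC : ∀ x ∈ C, x ∈ posInv (α.comp D.u.range.subtype))
    {M : Multiset (ZMod p × MvPolynomial σ ℂ)} (hM : ∀ y ∈ M, D.IsWeightForm α y.1 y.2)
    (ε : ℤ) (hε : ε ≠ 0) {F : Finset (ZMod p)} (hF : F.Nonempty)
    (hFε : ∀ a ∈ F, quadraticChar (ZMod p) a = ε)
    (hbig : ∀ a ∈ F, p * (1 + F.card) < 2 * (M.map Prod.fst).count a)
    (hgap : ∀ a ∈ F, ∀ g, quadraticChar (ZMod p) g = ε → g ∉ F →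
      2 * (M.map Prod.fst).count g + p * (1 + F.card) < 2 * (M.map Prod.fst).count a)
    (ih : ∀ M' : Multiset (ZMod p × MvPolynomial σ ℂ), (∀ y ∈ M', D.IsWeightForm α y.1 y.2) →
      M'.card = M.card → (M'.map Prod.fst).sum = (M.map Prod.fst).sum →
      ∑ w, (M'.map Prod.fst).count w ^ 2 < ∑ w, (M.map Prod.fst).count w ^ 2 →
      transfer α (C.prod * (M'.map Prod.snd).prod) ∈ decomposables α) :
    transfer α (C.prod * (M.map Prod.snd).prod) ∈ decomposables α := by
  classical
  have hp := (Fact.out : p.Prime)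
  have hlt : ∀ a ∈ F, p < (M.map Prod.fst).count a := by
    intro a ha
    have h1 := hbig a ha
    have h2 : 1 ≤ F.card := Finset.card_pos.2 hF
    nlinarith
  obtain ⟨w₀, hw₀⟩ := hF
  have h0 : ∀ a, quadraticChar (ZMod p) a = ε → a ≠ 0 := by
    rintro a ha rfl
    rw [quadraticChar_zero] at ha
    exact hε ha.symm
  have hw₀0 := h0 w₀ (hFε w₀ hw₀)
  have hc : ∀ a : F, ∃ c : (ZMod p)ˣ, (c : ZMod p) ^ 2 * w₀ = a := by
    rintro ⟨a, ha⟩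
    have ha0 := h0 a (hFε a ha)
    have h1 : quadraticChar (ZMod p) (a * w₀) = 1 := by
      rw [map_mul, hFε a ha, hFε w₀ hw₀]
      have := quadraticChar_sq_one ha0
      rwa [hFε a ha, sq] at this
    obtain ⟨s, hs⟩ := (quadraticChar_one_iff_isSquare (mul_ne_zero ha0 hw₀0)).1 h1
    have hs0 : s ≠ 0 := by
      rintro rfl
      simp [ha0, hw₀0] at hs
    refine ⟨Units.mk0 (s * w₀⁻¹) (mul_ne_zero hs0 (inv_ne_zero hw₀0)), ?_⟩
    rw [Units.val_mk0]
    field_simp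
    rw [sq, ← hs, mul_comm]
  choose c hc using hc
  have hle : ∑ a : F, Multiset.replicate p (a : ZMod p) ≤ M.map Prod.fst := by
    rw [Multiset.le_iff_count]
    intro a
    rw [Multiset.count_sum']
    simp only [Multiset.count_replicate]
    rw [Finset.sum_coe_sort F (fun x => if x = a then p else 0), Finset.sum_ite_eq']
    split_ifs with ha
    exacts [(hlt a ha).le, Nat.zero_le _]
  obtain ⟨B, R, rfl, hB⟩ := exists_eq_sum_add_of_le_map Prod.fst Finset.univ _ M hle
  replace hB := fun i => hB i (Finset.mem_univ i)
  have hBM : ∀ i, ∀ y ∈ B i, D.IsWeightForm α y.1 y.2 := fun i y hy =>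
    hM y (Multiset.mem_add.2 (.inl (Multiset.mem_sum.2 ⟨i, Finset.mem_univ i, hy⟩)))
  have hRM : ∀ y ∈ R, D.IsWeightForm α y.1 y.2 := fun y hy => hM y (Multiset.mem_add.2 (.inr hy))
  have hBfst : ∀ i, ∀ y ∈ B i, y.1 = i := by
    intro i y hy
    have := Multiset.mem_map_of_mem Prod.fst hy
    rw [hB] at this
    exact Multiset.eq_of_mem_replicate this
  have hB0 : ∀ i, B i ≠ 0 := by
    intro i hi
    have := congrArg Multiset.card (hB i)
    rw [hi, Multiset.card_replicate] at this
    exact hp.ne_zero this.symm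
  have hR0 : R ≠ 0 := by
    rintro rfl
    have := hlt w₀ hw₀
    rw [add_zero, map_finset_sum, Multiset.count_sum'] at this
    simp only [hB, Multiset.count_replicate] at this
    rw [Finset.sum_coe_sort F (fun x => if x = w₀ then p else 0), Finset.sum_ite_eq',
      if_pos hw₀] at this
    exact this.false
  have hprod : C.prod * ((∑ i, B i + R).map Prod.snd).prod =
      (C.prod * (R.map Prod.snd).prod) * ∏ i, ((B i).map Prod.snd).prod := by
    rw [Multiset.map_add, Multiset.prod_add, map_finset_sum, Multiset.prod_sum]
    ring
  rw [hprod]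
  have : Nonempty F := ⟨⟨w₀, hw₀⟩⟩
  refine transfer_exchange hα D.u.range (fun i => D.t (c i)) ?_ ?_ ?_ le_rfl ?_
  · intro i h hh
    refine (prod_eigenforms_mem_posInv exists_u_eq (hBM i) ?_ (hB0 i)).1 ⟨h, hh⟩
    rw [hB]
    simp
  · exact fun i => ⟨_, Multiset.card_pos.2 (hB0 i), isHomogeneous_prod_eigenforms (hBM i)⟩
  · have h1 : ∀ C : Multiset (MvPolynomial σ ℂ), (∀ x ∈ C, x ∈ posInv (α.comp D.u.range.subtype)) →
        ∃ a, C.prod.IsHomogeneous a := by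
      intro C hC
      by_cases hC0 : C = 0
      · exact ⟨0, by simpa [hC0] using isHomogeneous_one σ ℂ⟩
      · obtain ⟨a, _, ha⟩ := exists_isHomogeneous_multiset_prod (fun x hx => (hC x hx).2) hC0
        exact ⟨a, ha⟩
    obtain ⟨a, ha⟩ := h1 C hC
    exact ⟨a + R.card, Nat.add_pos_right _ (Multiset.card_pos.2 hR0),
      ha.mul (isHomogeneous_prod_eigenforms hRM)⟩
  · intro h hh I hI
    obtain ⟨a, y, rfl⟩ := D.exists_eq h
    have hmul : ∀ i, D.t a * D.u (.ofAdd y) * D.t (c i) =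
        D.t (a * c i) * D.u (.ofAdd (((c i)⁻¹ : (ZMod p)ˣ) ^ 2 * y)) := by
      intro i
      rw [mul_assoc, D.u_mul_t, ← mul_assoc, ← map_mul]
    set g : ZMod p := ((a⁻¹ : (ZMod p)ˣ) : ZMod p) ^ 2 * w₀ with hg
    have hmove : ∀ i : F, (((a * c i)⁻¹ : (ZMod p)ˣ) : ZMod p) ^ 2 * i = g := by
      intro i
      have h1 : (((c i)⁻¹ : (ZMod p)ˣ) : ZMod p) * c i = 1 := Units.inv_mul _
      rw [← hc i, hg, mul_inv, Units.val_mul]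
      linear_combination ((a⁻¹ : (ZMod p)ˣ) : ZMod p) ^ 2 * w₀ *
        ((((c i)⁻¹ : (ZMod p)ˣ) : ZMod p) * c i + 1) * h1
    have hgε : quadraticChar (ZMod p) g = ε := by
      rw [hg, map_mul, map_pow, quadraticChar_sq_one (Units.ne_zero _), one_mul, hFε w₀ hw₀]
    have hgF : g ∉ F := by
      intro hgF
      refine hh ⟨g, hgF⟩ ?_
      rw [hmul]
      have h1 : (a * c ⟨g, hgF⟩) ^ 2 = 1 := by
        have h2 := hmove ⟨g, hgF⟩
        have h3 : g ≠ 0 := h0 g hgε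
        have h4 := mul_right_cancel₀ h3 (h2.trans (one_mul g).symm)
        rw [← inv_inj, inv_one, ← inv_pow]
        refine Units.ext ?_
        rw [Units.val_pow_eq_pow_val, Units.val_one]
        exact h4
      rw [D.t_eq_one _ h1, one_mul]
      exact ⟨_, rfl⟩
    set N : F → Multiset (ZMod p × MvPolynomial σ ℂ) := fun i =>
      (B i).map fun z => (g, α (D.t a * D.u (.ofAdd y) * D.t (c i)) z.2) with hN
    set M' := ∑ i ∈ I, N i + ∑ i ∈ Iᶜ, B i + R with hM'
    have hNfst : ∀ i, (N i).map Prod.fst = Multiset.replicate p g := by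
      intro i
      rw [hN, Multiset.map_map]
      simp only [Function.comp_def, Multiset.map_const']
      rw [← Multiset.card_map Prod.fst, hB, Multiset.card_replicate]
    have hM'w : ∀ y ∈ M', D.IsWeightForm α y.1 y.2 := by
      intro z hz
      rw [hM', Multiset.mem_add, Multiset.mem_add, Multiset.mem_sum, Multiset.mem_sum] at hz
      rcases hz with (⟨i, _, hz⟩ | ⟨i, _, hz⟩) | hz
      · obtain ⟨z', hz', rfl⟩ := Multiset.mem_map.1 hz
        have h1 := (hBM i z' hz').move hα (a * c i) (((c i)⁻¹ : (ZMod p)ˣ) ^ 2 * y)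
        rw [hBfst i z' hz', hmove i, ← hmul] at h1
        exact h1
      · exact hBM i z hz
      · exact hRM z hz
    have hfst : M'.map Prod.fst + ∑ i ∈ I, Multiset.replicate p (i : ZMod p) =
        (∑ i, B i + R).map Prod.fst + Multiset.replicate (p * I.card) g := by
      rw [← Finset.sum_add_sum_compl I B, hM']
      simp only [Multiset.map_add, map_finset_sum, hNfst, hB, Finset.sum_const]
      rw [Multiset.nsmul_replicate, mul_comm]
      abel
    have hgoal : transfer α (C.prod * (M'.map Prod.snd).prod) ∈ decomposables α := by
      refine ih M' hM'w ?_ ?_ ?_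
      · have := congrArg Multiset.card hfst
        simp only [Multiset.card_add, Multiset.card_map, Multiset.card_sum,
          Multiset.card_replicate, Finset.sum_const, smul_eq_mul] at this
        rw [mul_comm p] at this
        simp only [Multiset.card_add, Multiset.card_sum]
        omega
      · have := congrArg Multiset.sum hfst
        simpa [Multiset.sum_add, Multiset.sum_sum, Multiset.sum_replicate] using this
      · have hcardI : (I.map (Function.Embedding.subtype _)).card = I.card := Finset.card_map _
        have hIF : I.card ≤ F.card := by
          simpa using Finset.card_le_univ I
        refine sum_sq_lt_sum_sq hp.pos (I := I.map (Function.Embedding.subtype _)) (g := g)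
          (hI.map) ?_ ?_ ?_
        · intro hgI
          obtain ⟨i, _, hi⟩ := Finset.mem_map.1 hgI
          exact hgF (hi ▸ i.2)
        · intro w
          have := congrArg (Multiset.count w) hfst
          rw [Multiset.count_add, Multiset.count_add, Multiset.count_sum'] at this
          simp only [Multiset.count_replicate] at this
          rw [hcardI]
          have h2 : ∑ x ∈ I, (if (x : ZMod p) = w then p else 0) =
              if w ∈ I.map (Function.Embedding.subtype _) then p else 0 := by
            rw [← Finset.sum_ite_eq' (I.map (Function.Embedding.subtype _)) w (fun _ => p),
              Finset.sum_map]
            rfl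
          rw [h2] at this
          exact this.trans (congrArg _ (if_congr eq_comm rfl rfl))
        · intro i hi
          obtain ⟨i, _, rfl⟩ := Finset.mem_map.1 hi
          have h1 := hgap i i.2 g hgε hgF
          rw [hcardI]
          refine lt_of_le_of_lt ?_ h1
          gcongr
    have hfin : (C.prod * (R.map Prod.snd).prod) *
        ((∏ i ∈ I, α (D.t a * D.u (.ofAdd y) * D.t (c i)) ((B i).map Prod.snd).prod) *
          ∏ i ∈ Iᶜ, ((B i).map Prod.snd).prod) = C.prod * (M'.map Prod.snd).prod := by
      rw [hM', Multiset.map_add, Multiset.map_add, Multiset.prod_add, Multiset.prod_add,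
        map_finset_sum, map_finset_sum, Multiset.prod_sum, Multiset.prod_sum]
      simp only [hN, Multiset.map_map, Function.comp_def, map_multiset_prod]
      ring
    rw [hfin]
    exact hgoal

end BorelDatum

end NoetherBound

namespace NoetherBound

open MvPolynomial

/-- The elements of `ZMod p` with given quadratic character. -/
def quadraticClass (p : ℕ) [Fact p.Prime] (ε : ℤ) : Finset (ZMod p) :=
  Finset.univ.filter fun w => quadraticChar (ZMod p) w = ε

lemma sum_eq_sum_quadraticClass {p : ℕ} [Fact p.Prime] (f : ZMod p → ℕ) (h0 : f 0 = 0) :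
    ∑ w, f w = ∑ w ∈ quadraticClass p 1, f w + ∑ w ∈ quadraticClass p (-1), f w := by
  rw [quadraticClass, quadraticClass, Finset.sum_filter, Finset.sum_filter,
    ← Finset.sum_add_distrib]
  refine Finset.sum_congr rfl fun w _ => ?_
  by_cases hw : w = 0
  · simp [hw, h0]
  · rcases quadraticChar_dichotomy hw with h | h <;> simp [h]

/-- A bound on the size of a multiset of nonzero residues without gaps and with few heavy
elements. -/
lemma card_le_of_no_gap {p : ℕ} [Fact p.Prime] {j k : ℕ} {m : Multiset (ZMod p)}
    (h0 : m.count 0 = 0) (hmin : ∑ w, min (m.count w) j < j * (k + 1))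
    (hgap : ∀ ε : ℤ, ε ≠ 0 → ∀ F ⊆ quadraticClass p ε, F.Nonempty →
      ¬ ∀ a ∈ F, 2 * j + p * (1 + F.card) < 2 * m.count a ∧
        ∀ g ∈ quadraticClass p ε \ F, 2 * m.count g + p * (1 + F.card) < 2 * m.count a) :
    6 * m.card + 6 ≤ 6 * (j * (k + 1)) + p * (k * (k + 1) * (k + 2)) := by
  have h1 := sum_excess_le_of_no_gap _ m.count p _ j (hgap 1 (by simp)) rfl
  have h2 := sum_excess_le_of_no_gap _ m.count p _ j (hgap (-1) (by simp)) rfl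
  set x := ((quadraticClass p 1).filter fun w => j < m.count w).card with hx
  set y := ((quadraticClass p (-1)).filter fun w => j < m.count w).card with hy
  have h3 : x + y = ∑ w, if j < m.count w then 1 else 0 := by
    rw [sum_eq_sum_quadraticClass _ (by simp [h0]), hx, hy, Finset.card_filter,
      Finset.card_filter]
  have h4 : j * (x + y) ≤ ∑ w, min (m.count w) j := by
    rw [h3, Finset.mul_sum]
    refine Finset.sum_le_sum fun w _ => ?_
    split_ifs
    · rw [mul_one]
      omega
    · simp
  have hxy : x + y ≤ k := by
    have := Nat.lt_of_mul_lt_mul_left (h4.trans_lt hmin)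
    omega
  have h5 : 2 * m.card = 2 * (∑ w, min (m.count w) j) + ∑ w, (2 * m.count w - 2 * j) := by
    rw [← Multiset.sum_count_eq_card (s := Finset.univ) (m := m) (fun a _ => Finset.mem_univ a),
      Finset.mul_sum, Finset.mul_sum, ← Finset.sum_add_distrib]
    refine Finset.sum_congr rfl fun w _ => ?_
    omega
  have h6 := sum_eq_sum_quadraticClass (fun w => 2 * m.count w - 2 * j) (by simp [h0])
  have h7 : p * (x * (x + 1) * (x + 2)) + p * (y * (y + 1) * (y + 2)) ≤
      p * (k * (k + 1) * (k + 2)) := by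
    calc p * (x * (x + 1) * (x + 2)) + p * (y * (y + 1) * (y + 2))
        = p * (x * (x + 1) * (x + 2) + y * (y + 1) * (y + 2)) := by ring
      _ ≤ p * ((x + y) * (x + y + 1) * (x + y + 2)) := by
        refine Nat.mul_le_mul_left p ?_
        have : (x + y) * (x + y + 1) * (x + y + 2) = x * (x + 1) * (x + 2) +
          y * (y + 1) * (y + 2) + (3 * x * x * y + 3 * x * y * y + 6 * x * y) := by ring
        omega
      _ ≤ p * (k * (k + 1) * (k + 2)) := by gcongr
  omega

namespace BorelDatum

variable {σ : Type*} {G : Type*} [Group G] {p : ℕ} [Fact p.Prime] {D : BorelDatum p G}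
  {α : G →* (MvPolynomial σ ℂ →ₐ[ℂ] MvPolynomial σ ℂ)}

lemma exists_blocks (N : ℕ) :
    ∀ M : Multiset (ZMod p × MvPolynomial σ ℂ), M.card = N →
      (∀ y ∈ M, D.IsWeightForm α y.1 y.2) → (M.map Prod.fst).sum = 0 →
      ∃ C : Multiset (MvPolynomial σ ℂ), (∀ x ∈ C, x ∈ posInv (α.comp D.u.range.subtype)) ∧
        C.prod = (M.map Prod.snd).prod ∧ (M.card + 1) / p ≤ C.card := by
  have hp := (Fact.out : p.Prime)
  induction N using Nat.strong_induction_on with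
  | _ N ih =>
    intro M hMN hM hsum
    by_cases hlt : 2 * p - 1 ≤ M.card
    · obtain ⟨t, ht, htc, hts⟩ := ZMod.erdos_ginzburg_ziv_multiset (M.map Prod.fst)
        (by rwa [Multiset.card_map])
      obtain ⟨M₁, M₂, rfl, rfl⟩ := exists_le_of_le_map Prod.fst t M ht
      rw [Multiset.card_map] at htc
      rw [Multiset.map_add, Multiset.sum_add, hts, zero_add] at hsum
      rw [Multiset.card_add] at hMN hlt
      have hp0 := hp.pos
      obtain ⟨C, hC, hCp, hCc⟩ := ih M₂.card (by omega) M₂ rfl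
        (fun y hy => hM y (Multiset.mem_add.2 (.inr hy))) hsum
      refine ⟨(M₁.map Prod.snd).prod ::ₘ C, ?_, ?_, ?_⟩
      · intro x hx
        rcases Multiset.mem_cons.1 hx with rfl | hx
        · refine prod_eigenforms_mem_posInv exists_u_eq
            (fun y hy => hM y (Multiset.mem_add.2 (.inl hy))) hts ?_
          rintro rfl
          exact hp.ne_zero (by simpa using htc.symm)
        · exact hC x hx
      · rw [Multiset.prod_cons, hCp, Multiset.map_add, Multiset.prod_add]
      · rw [Multiset.card_add, htc, Multiset.card_cons, add_assoc, Nat.add_div_left _ hp.pos]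
        omega
    · by_cases hM0 : M = 0
      · subst hM0
        refine ⟨0, by simp, by simp, ?_⟩
        simp [Nat.div_eq_of_lt hp.one_lt]
      · refine ⟨{(M.map Prod.snd).prod}, ?_, by simp, ?_⟩
        · intro x hx
          rw [Multiset.mem_singleton.1 hx]
          exact prod_eigenforms_mem_posInv exists_u_eq hM hsum hM0
        · rw [Multiset.card_singleton, ← Nat.lt_succ_iff, Nat.div_lt_iff_lt_mul hp.pos]
          have := hp.one_lt
          omega

/-- A Noether bound for groups with a Borel structure, depending on two parameters `j`, `k`. -/
theorem decomposableAbove [Finite G] (D : BorelDatum p G) (hα : IsGraded α) {n j k d : ℕ}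
    (hindex : D.u.range.index ≤ n) (hj : 0 < j) (hkj : p ≤ j * k + 1)
    (hnum : ∀ N c, 6 * N + 6 ≤ 6 * (j * (k + 1)) + p * (k * (k + 1) * (k + 2)) →
      c + (N + 1) / p ≤ n → j * c + N ≤ d) : DecomposableAbove α d := by
  classical
  let _ := Fintype.ofFinite G
  refine decomposableAbove_of_zero_sum (u := fun x => D.u (.ofAdd x))
    (ψ := fun x => (ZMod.stdAddChar (N := p)).mulShift x) (mem_span_isWeightForm hα) ?_ ?_
  · refine fun w hw => ⟨1, fun h => hw (ZMod.injective_stdAddChar (N := p) ?_)⟩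
    rw [AddChar.mulShift_apply, one_mul] at h
    rw [h, AddChar.map_zero_eq_one]
  have key : ∀ (N s : ℕ) (M : Multiset (ZMod p × MvPolynomial σ ℂ)), M.card = N →
      ∑ w, (M.map Prod.fst).count w ^ 2 = s → ∀ C : Multiset (MvPolynomial σ ℂ),
      (∀ x ∈ C, x ∈ posInv (α.comp D.u.range.subtype)) →
      (∀ y ∈ M, D.IsWeightForm α y.1 y.2) → (M.map Prod.fst).sum = 0 →
      d < j * C.card + M.card →
      transfer α (C.prod * (M.map Prod.snd).prod) ∈ decomposables α := by
    intro N
    induction N using Nat.strong_induction_on with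
    | _ N ihN =>
    intro s
    induction s using Nat.strong_induction_on with
    | _ s ihs =>
    intro M hMN hMs C hC hM hsum hd
    by_cases hblocks : n < C.card + (M.card + 1) / p
    · obtain ⟨C', hC', hCp, hCc⟩ := exists_blocks _ M rfl hM hsum
      rw [← hCp, ← Multiset.prod_add]
      refine transfer_prod_mem_of_index_lt hα D.u.range (fun x hx => ?_) ?_
      · rcases Multiset.mem_add.1 hx with hx | hx
        exacts [hC x hx, hC' x hx]
      · rw [Multiset.card_add]
        omega
    by_cases hshort : ∃ t ≤ M.map Prod.fst, 0 < t.card ∧ t.card ≤ j ∧ t.sum = 0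
    · obtain ⟨t, ht, ht0, htj, hts⟩ := hshort
      obtain ⟨M₁, M₂, rfl, rfl⟩ := exists_le_of_le_map Prod.fst t M ht
      rw [Multiset.card_map] at ht0 htj
      rw [Multiset.map_add, Multiset.sum_add, hts, zero_add] at hsum
      rw [Multiset.card_add] at hMN hd
      have h1 := ihN M₂.card (by omega) _ M₂ rfl rfl ((M₁.map Prod.snd).prod ::ₘ C) ?_
        (fun y hy => hM y (Multiset.mem_add.2 (.inr hy))) hsum ?_
      · rw [Multiset.map_add, Multiset.prod_add]
        rw [Multiset.prod_cons] at h1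
        rwa [← mul_assoc, mul_comm C.prod]
      · intro x hx
        rcases Multiset.mem_cons.1 hx with rfl | hx
        · exact prod_eigenforms_mem_posInv exists_u_eq
            (fun y hy => hM y (Multiset.mem_add.2 (.inl hy))) hts (Multiset.card_pos.1 ht0)
        · exact hC x hx
      · rw [Multiset.card_cons, mul_add]
        omega
    have h0 : (M.map Prod.fst).count 0 = 0 := by
      by_contra h
      exact hshort ⟨{0}, Multiset.singleton_le.2 (Multiset.count_ne_zero.1 h), by simp,
        by simpa using Nat.succ_le_of_lt hj, by simp⟩
    have hmin : ∑ w, min ((M.map Prod.fst).count w) j < j * (k + 1) := by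
      by_contra! h
      obtain ⟨t, ht, htc, hts⟩ := exists_zero_sum_card hkj _ h
      exact hshort ⟨t, ht, by omega, by omega, hts⟩
    by_cases hgap : ∃ ε : ℤ, ε ≠ 0 ∧ ∃ F ⊆ quadraticClass p ε, F.Nonempty ∧
      ∀ a ∈ F, 2 * j + p * (1 + F.card) < 2 * (M.map Prod.fst).count a ∧
        ∀ g ∈ quadraticClass p ε \ F,
          2 * (M.map Prod.fst).count g + p * (1 + F.card) < 2 * (M.map Prod.fst).count a
    · obtain ⟨ε, hε, F, hFε, hF, hFgap⟩ := hgap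
      refine transfer_mem_of_gap hα hC hM ε hε hF (fun a ha => (Finset.mem_filter.1 (hFε ha)).2)
        (fun a ha => by have := (hFgap a ha).1; omega) (fun a ha g hg hgF => ?_) ?_
      · exact (hFgap a ha).2 g
          (Finset.mem_sdiff.2 ⟨Finset.mem_filter.2 ⟨Finset.mem_univ g, hg⟩, hgF⟩)
      · intro M' hM' hcard hsum' hsq
        exact ihs _ (hMs ▸ hsq) M' (hcard.trans hMN) rfl C hC hM' (hsum'.trans hsum)
          (by rwa [hcard])
    · have h1 := card_le_of_no_gap h0 hmin fun ε hε F hF hF0 h =>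
        hgap ⟨ε, hε, F, hF, hF0, h⟩
      rw [Multiset.card_map] at h1
      have := hnum M.card C.card h1 (by omega)
      omega
  intro M hM hsum hd
  have := key _ _ M rfl rfl 0 (by simp) hM hsum (by simpa using hd)
  simpa using this

end BorelDatum

end NoetherBound

namespace NoetherBound

open Matrix

variable {p : ℕ}

lemma mem_center_SL_two_iff {F : Type*} [Field F] {A : SpecialLinearGroup (Fin 2) F} :
    A ∈ Subgroup.center (SpecialLinearGroup (Fin 2) F) ↔ A = 1 ∨ A = -1 := by
  rw [Matrix.SpecialLinearGroup.mem_center_iff]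
  constructor
  · rintro ⟨r, hr, hA⟩
    rw [Fintype.card_fin] at hr
    rcases mul_self_eq_one_iff.1 ((sq r).symm.trans hr) with rfl | rfl
    · exact Or.inl (Subtype.ext (by simp [← hA]))
    · exact Or.inr (Subtype.ext (by simp [← hA, ← Matrix.diagonal_one, Matrix.diagonal_neg]))
  · rintro (rfl | rfl)
    · exact ⟨1, by simp, by simp⟩
    · exact ⟨-1, by simp, by simp [← Matrix.diagonal_one, Matrix.diagonal_neg]⟩

lemma neg_one_ne_one_SL_two (hp : 2 < p) : (-1 : SpecialLinearGroup (Fin 2) (ZMod p)) ≠ 1 := by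
  intro h
  have : Fact (2 < p) := ⟨hp⟩
  have := congrFun (congrFun (congrArg Subtype.val h) 0) 0
  simp at this
  exact ZMod.neg_one_ne_one this

variable [Fact p.Prime]

lemma card_center_SL_two (hp : 2 < p) :
    Nat.card (Subgroup.center (SpecialLinearGroup (Fin 2) (ZMod p))) = 2 := by
  have h : (Subgroup.center (SpecialLinearGroup (Fin 2) (ZMod p)) :
      Set (SpecialLinearGroup (Fin 2) (ZMod p))) = {1, -1} := by
    ext A
    exact mem_center_SL_two_iff
  rw [← SetLike.coe_sort_coe, Nat.card_coe_set_eq, h,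
    Set.ncard_pair (neg_one_ne_one_SL_two hp).symm]

lemma card_SL_two : Nat.card (SpecialLinearGroup (Fin 2) (ZMod p)) = p * (p + 1) * (p - 1) := by
  have hp := (Fact.out : p.Prime)
  set f : GL (Fin 2) (ZMod p) →* (ZMod p)ˣ := GeneralLinearGroup.det with hf
  have h1 := Subgroup.card_mul_index f.ker
  have hsurj : Function.Surjective f := by
    intro u
    refine ⟨GeneralLinearGroup.mkOfDetNeZero !![(u : ZMod p), 0; 0, 1] (by simp), ?_⟩
    ext
    simp [hf]
  have h2 : f.ker.index = p - 1 := by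
    rw [Subgroup.index_ker, MonoidHom.range_eq_top.2 hsurj, Subgroup.card_top,
      Nat.card_eq_fintype_card, ZMod.card_units]
  have h3 : Nat.card f.ker = Nat.card (SpecialLinearGroup (Fin 2) (ZMod p)) := by
    refine (Nat.card_eq_of_bijective
      (fun A : SpecialLinearGroup (Fin 2) (ZMod p) =>
        (⟨(A : GL (Fin 2) (ZMod p)), ?_⟩ : f.ker)) ⟨?_, ?_⟩).symm
    · rw [MonoidHom.mem_ker]; ext; simp [hf]
    · intro A B h
      have := congrArg (fun x : f.ker => (x.1 : Matrix (Fin 2) (Fin 2) (ZMod p))) h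
      exact Subtype.ext this
    · rintro ⟨g, hg⟩
      refine ⟨⟨g.1, ?_⟩, ?_⟩
      · simpa [hf] using congrArg Units.val (MonoidHom.mem_ker.1 hg)
      · ext; rfl
  rw [h3, h2, card_GL_field] at h1
  simp [Fin.prod_univ_two, ZMod.card, -Nat.card_eq_fintype_card] at h1
  have h4 : 0 < p - 1 := by have := hp.two_le; omega
  refine Nat.eq_of_mul_eq_mul_right h4 (h1.trans ?_)
  obtain ⟨q, rfl⟩ : ∃ q, p = q + 1 := ⟨p - 1, by omega⟩
  have e1 : (q + 1) ^ 2 - 1 = (q + 1 + 1) * q := Nat.sub_eq_of_eq_add (by ring)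
  have e2 : (q + 1) ^ 2 - (q + 1) = (q + 1) * q := Nat.sub_eq_of_eq_add (by ring)
  rw [e1, e2]
  simp
  ring

lemma card_PSL_two (hp : 2 < p) : Nat.card (ProjectiveSpecialLinearGroup (Fin 2) (ZMod p)) * 2 =
    p * (p + 1) * (p - 1) := by
  rw [← card_SL_two, Subgroup.card_eq_card_quotient_mul_card_subgroup
    (Subgroup.center (SpecialLinearGroup (Fin 2) (ZMod p))), card_center_SL_two hp]

lemma mk_PSL_two_eq_iff {F : Type*} [Field F] {A B : SpecialLinearGroup (Fin 2) F} :
    (A : ProjectiveSpecialLinearGroup (Fin 2) F) = B ↔ A = B ∨ A = -B := by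
  rw [eq_comm, QuotientGroup.eq, mem_center_SL_two_iff, inv_mul_eq_iff_eq_mul,
    inv_mul_eq_iff_eq_mul]
  simp

/-- The upper triangular matrices. -/
def borelSL (F : Type*) [Field F] : Subgroup (SpecialLinearGroup (Fin 2) F) where
  carrier := {A | A 1 0 = 0}
  one_mem' := by simp
  mul_mem' {A B} hA hB := by
    simp only [Set.mem_ofPred_eq] at *
    simp [Matrix.mul_apply, hA, hB]
  inv_mem' {A} hA := by
    simp only [Set.mem_ofPred_eq] at *
    simp [Matrix.SpecialLinearGroup.coe_inv, Matrix.adjugate_fin_two, hA]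

/-- The diagonal matrix with entries `a` and `a⁻¹`. -/
def diagSL (F : Type*) [Field F] : Fˣ →* SpecialLinearGroup (Fin 2) F where
  toFun a := ⟨!![(a : F), 0; 0, ((a⁻¹ : Fˣ) : F)], by simp⟩
  map_one' := by ext i j; fin_cases i <;> fin_cases j <;> simp
  map_mul' a b := by
    refine Subtype.ext (show !![((a * b : Fˣ) : F), 0; 0, (((a * b)⁻¹ : Fˣ) : F)] =
      !![(a : F), 0; 0, ((a⁻¹ : Fˣ) : F)] * !![(b : F), 0; 0, ((b⁻¹ : Fˣ) : F)] from ?_)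
    simp [mul_comm]

/-- The unipotent upper triangular matrix with entry `x`. -/
def unipSL (F : Type*) [Field F] : Multiplicative F →* SpecialLinearGroup (Fin 2) F where
  toFun x := ⟨!![1, x.toAdd; 0, 1], by simp⟩
  map_one' := by ext i j; fin_cases i <;> fin_cases j <;> simp
  map_mul' a b := by
    refine Subtype.ext (show !![1, (a * b).toAdd; 0, 1] =
      !![1, a.toAdd; 0, 1] * !![1, b.toAdd; 0, 1] from ?_)
    simp [add_comm]

lemma coe_diagSL {F : Type*} [Field F] (a : Fˣ) :
    (diagSL F a : Matrix (Fin 2) (Fin 2) F) = !![(a : F), 0; 0, ((a⁻¹ : Fˣ) : F)] := rfl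

lemma coe_unipSL {F : Type*} [Field F] (x : F) :
    (unipSL F (.ofAdd x) : Matrix (Fin 2) (Fin 2) F) = !![1, x; 0, 1] := rfl

lemma diagSL_mem {F : Type*} [Field F] (a : Fˣ) : diagSL F a ∈ borelSL F := by
  show (diagSL F a : Matrix (Fin 2) (Fin 2) F) 1 0 = 0
  simp [coe_diagSL]

lemma unipSL_mem {F : Type*} [Field F] (x : Multiplicative F) : unipSL F x ∈ borelSL F := by
  show (unipSL F x : Matrix (Fin 2) (Fin 2) F) 1 0 = 0
  rw [← ofAdd_toAdd x, coe_unipSL]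
  simp

lemma unipSL_mul_diagSL {F : Type*} [Field F] (x : F) (a : Fˣ) :
    unipSL F (.ofAdd x) * diagSL F a =
      diagSL F a * unipSL F (.ofAdd (((a⁻¹ : Fˣ) : F) ^ 2 * x)) := by
  ext i j
  rw [Matrix.SpecialLinearGroup.coe_mul, Matrix.SpecialLinearGroup.coe_mul, coe_diagSL,
    coe_unipSL, coe_unipSL]
  fin_cases i <;> fin_cases j <;> simp
  field_simp

lemma exists_eq_of_mem_borelSL {F : Type*} [Field F] {A : SpecialLinearGroup (Fin 2) F}
    (hA : A ∈ borelSL F) : ∃ a x, A = diagSL F a * unipSL F (.ofAdd x) := by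
  have hA : A 1 0 = 0 := hA
  have hdet := A.det_coe
  rw [Matrix.det_fin_two, hA, mul_zero, sub_zero] at hdet
  refine ⟨⟨A 0 0, A 1 1, hdet, by rw [mul_comm, hdet]⟩, A 1 1 * A 0 1, ?_⟩
  ext i j
  rw [Matrix.SpecialLinearGroup.coe_mul, coe_diagSL, coe_unipSL]
  fin_cases i <;> fin_cases j <;> simp [hA, ← mul_assoc, hdet]

lemma card_borelSL : Nat.card (borelSL (ZMod p)) = (p - 1) * p := by
  have : Nat.card ((ZMod p)ˣ × ZMod p) = (p - 1) * p := by
    rw [Nat.card_prod, Nat.card_zmod, Nat.card_eq_fintype_card, ZMod.card_units]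
  rw [← this]
  refine (Nat.card_eq_of_bijective (fun z => (⟨diagSL _ z.1 * unipSL _ (.ofAdd z.2),
    mul_mem (diagSL_mem _) (unipSL_mem _)⟩ : borelSL (ZMod p))) ⟨?_, ?_⟩).symm
  · rintro ⟨a, x⟩ ⟨b, y⟩ h
    have h : diagSL _ a * unipSL _ (.ofAdd x) = diagSL _ b * unipSL _ (.ofAdd y) :=
      congrArg Subtype.val h
    have h := congrArg Subtype.val h
    rw [Matrix.SpecialLinearGroup.coe_mul, Matrix.SpecialLinearGroup.coe_mul, coe_diagSL,
      coe_unipSL, coe_diagSL, coe_unipSL] at h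
    have h0 := congrFun (congrFun h 0) 0
    have h1 := congrFun (congrFun h 0) 1
    simp only [Matrix.mul_fin_two, Matrix.of_apply, Matrix.cons_val_zero, Matrix.cons_val_one,
      mul_one, mul_zero, zero_mul, add_zero, zero_add] at h0 h1
    obtain rfl := Units.ext h0
    simpa using h1
  · rintro ⟨A, hA⟩
    obtain ⟨a, x, rfl⟩ := exists_eq_of_mem_borelSL hA
    exact ⟨(a, x), rfl⟩

lemma index_borelSL : (borelSL (ZMod p)).index = p + 1 := by
  have hp := (Fact.out : p.Prime).two_le
  have h := Subgroup.card_mul_index (borelSL (ZMod p))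
  rw [card_borelSL, card_SL_two] at h
  have h0 : 0 < (p - 1) * p := Nat.mul_pos (by omega) (by omega)
  exact Nat.eq_of_mul_eq_mul_left h0 (h.trans (by ring))

/-- The image of the upper triangular matrices. -/
def borelPSL (F : Type*) [Field F] : Subgroup (ProjectiveSpecialLinearGroup (Fin 2) F) :=
  (borelSL F).map (QuotientGroup.mk' _)

lemma index_borelPSL : (borelPSL (ZMod p)).index = p + 1 := by
  rw [borelPSL, Subgroup.index_map_eq _ (QuotientGroup.mk'_surjective _), index_borelSL]
  rw [QuotientGroup.ker_mk']
  intro A hA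
  show A 1 0 = 0
  rcases mem_center_SL_two_iff.1 hA with rfl | rfl <;> simp

/-- The torus and the unipotent radical of the Borel subgroup. -/
def borelDatumPSL (p : ℕ) [Fact p.Prime] : BorelDatum p (borelPSL (ZMod p)) where
  u := ((QuotientGroup.mk' _).comp (unipSL (ZMod p))).codRestrict _
    fun x => ⟨_, unipSL_mem x, rfl⟩
  t := ((QuotientGroup.mk' _).comp (diagSL (ZMod p))).codRestrict _
    fun x => ⟨_, diagSL_mem x, rfl⟩
  u_mul_t x a := by
    refine Subtype.ext ?_
    exact congrArg (QuotientGroup.mk' _) (unipSL_mul_diagSL x a)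
  t_eq_one a ha := by
    refine Subtype.ext ?_
    refine mk_PSL_two_eq_iff.2 ?_
    have ha' : (a : ZMod p) * a = 1 := by rw [← Units.val_mul, ← sq, ha, Units.val_one]
    rcases mul_self_eq_one_iff.1 ha' with h | h
    · left
      rw [show a = 1 from Units.ext h, map_one]
    · right
      rw [show a = -1 from Units.ext h]
      ext i j
      rw [coe_diagSL]
      fin_cases i <;> fin_cases j <;> simp
  exists_eq := by
    rintro ⟨_, A, hA, rfl⟩
    obtain ⟨a, x, rfl⟩ := exists_eq_of_mem_borelSL hA
    exact ⟨a, x, Subtype.ext (map_mul _ _ _)⟩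

lemma index_range_u_borelDatumPSL (hp : 2 < p) :
    (borelDatumPSL p).u.range.index = (p - 1) / 2 := by
  have h1 := Subgroup.card_mul_index (borelPSL (ZMod p))
  have h2 := Subgroup.card_mul_index (borelDatumPSL p).u.range
  have h3 := card_PSL_two (p := p) hp
  have hinj : Function.Injective (borelDatumPSL p).u := by
    rw [injective_iff_map_eq_one]
    intro x hx
    have hx := congrArg Subtype.val hx
    rcases mk_PSL_two_eq_iff.1 hx with h | h
    all_goals
      have h := congrArg Subtype.val h
      rw [← ofAdd_toAdd x, coe_unipSL] at h
      have := congrFun (congrFun h 0) 1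
      simpa using this
  have h4 : Nat.card (borelDatumPSL p).u.range = p := by
    rw [← Nat.card_congr (MonoidHom.ofInjective hinj).toEquiv]
    exact Nat.card_zmod p
  rw [index_borelPSL] at h1
  rw [h4] at h2
  rw [← h1, ← h2] at h3
  have : (borelDatumPSL p).u.range.index * 2 = p - 1 := by
    have h0 : 0 < p * (p + 1) := Nat.mul_pos (by omega) (by omega)
    refine Nat.eq_of_mul_eq_mul_left h0 (Eq.trans ?_ h3)
    ring
  omega

/-- The subgroup consisting of `1`, `a`, `b` and `a * b`. -/
def fourSubgroup {G : Type*} [Group G] (a b : G) (ha : a * a = 1) (hb : b * b = 1)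
    (hab : a * b = b * a) : Subgroup G where
  carrier := {1, a, b, a * b}
  one_mem' := by simp
  mul_mem' {x y} hx hy := by
    have h1 : a * (a * b) = b := by rw [← mul_assoc, ha, one_mul]
    have h2 : a * b * b = a := by rw [mul_assoc, hb, mul_one]
    have h3 : b * (a * b) = a := by rw [← mul_assoc, ← hab, h2]
    have h4 : a * b * a = b := by rw [mul_assoc, ← hab, h1]
    have h5 : a * b * (a * b) = 1 := by rw [← mul_assoc, h4, hb]
    simp only [Set.mem_insert_iff, Set.mem_singleton_iff] at hx hy ⊢
    rcases hx with rfl | rfl | rfl | rfl <;> rcases hy with rfl | rfl | rfl | rfl <;>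
      simp [ha, hb, h1, h2, h3, h4, h5, ← hab]
  inv_mem' {x} hx := by
    simp only [Set.mem_insert_iff, Set.mem_singleton_iff] at hx ⊢
    have ha' : a⁻¹ = a := inv_eq_of_mul_eq_one_left ha
    have hb' : b⁻¹ = b := inv_eq_of_mul_eq_one_left hb
    rcases hx with rfl | rfl | rfl | rfl <;> simp [ha', hb', hab]

theorem decomposableAbove_of_four {σ G : Type*} [Group G] [Finite G]
    {α : G →* (MvPolynomial σ ℂ →ₐ[ℂ] MvPolynomial σ ℂ)} (hα : IsGraded α) {a b : G}
    (ha : a * a = 1) (hb : b * b = 1) (hab : a * b = b * a) (ha1 : a ≠ 1) (hb1 : b ≠ 1)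
    (hne : a ≠ b) : DecomposableAbove α (Nat.card G / 4 * 3) := by
  set H := fourSubgroup a b ha hb hab with hH
  have hcard : Nat.card H = 4 := by
    have h : (H : Set G) = {1, a, b, a * b} := rfl
    rw [← SetLike.coe_sort_coe, Nat.card_coe_set_eq, h]
    have : a * b ≠ 1 := fun h => hne (by rw [← mul_one a, ← hb, ← mul_assoc, h, one_mul])
    rw [Set.ncard_insert_of_notMem, Set.ncard_insert_of_notMem, Set.ncard_pair]
    · simpa using ha1
    · simp [hne, hb1]
    · simp [ha1.symm, hb1.symm, this.symm]
  have hindex : Nat.card G / 4 = H.index := by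
    rw [← Subgroup.card_mul_index H, hcard]
    simp
  rw [hindex]
  refine DecomposableAbove.of_subgroup hα H ?_
  refine decomposableAbove_three (fun g => hα g) (a := (⟨a, by right; left; rfl⟩ : H))
    (b := ⟨b, by right; right; left; rfl⟩) (Subtype.ext ha) (Subtype.ext hb) (Subtype.ext hab) ?_
  rintro ⟨g, hg⟩
  rcases hg with rfl | rfl | rfl | hg
  · exact Or.inl rfl
  · exact Or.inr (Or.inl rfl)
  · exact Or.inr (Or.inr (Or.inl rfl))
  · exact Or.inr (Or.inr (Or.inr (Subtype.ext hg)))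

theorem exists_four_PSL_two (hp : 2 < p) :
    ∃ a b : ProjectiveSpecialLinearGroup (Fin 2) (ZMod p),
      a * a = 1 ∧ b * b = 1 ∧ a * b = b * a ∧ a ≠ 1 ∧ b ≠ 1 ∧ a ≠ b := by
  obtain ⟨x, y, hxy⟩ := ZMod.sq_add_sq p (-1)
  set A : SpecialLinearGroup (Fin 2) (ZMod p) := ⟨!![0, 1; -1, 0], by simp⟩ with hA
  set B : SpecialLinearGroup (Fin 2) (ZMod p) := ⟨!![x, y; y, -x], by
    rw [Matrix.det_fin_two_of]; linear_combination -hxy⟩ with hB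
  have : Fact (2 < p) := ⟨hp⟩
  have h1 := ZMod.neg_one_ne_one (n := p)
  refine ⟨(A : ProjectiveSpecialLinearGroup (Fin 2) (ZMod p)), B, ?_, ?_, ?_, ?_, ?_, ?_⟩
  · refine mk_PSL_two_eq_iff.2 (Or.inr ?_)
    ext i j
    rw [Matrix.SpecialLinearGroup.coe_mul, hA]
    fin_cases i <;> fin_cases j <;> simp
  · refine mk_PSL_two_eq_iff.2 (Or.inr ?_)
    ext i j
    rw [Matrix.SpecialLinearGroup.coe_mul, hB]
    fin_cases i <;> fin_cases j <;> simp <;> first | ring1 | linear_combination hxy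
  · refine mk_PSL_two_eq_iff.2 (Or.inr ?_)
    ext i j
    rw [Matrix.SpecialLinearGroup.coe_neg, Matrix.SpecialLinearGroup.coe_mul,
      Matrix.SpecialLinearGroup.coe_mul, hA, hB]
    fin_cases i <;> fin_cases j <;> simp
  · intro h
    rcases mk_PSL_two_eq_iff.1 h with h | h
    all_goals
      have := congrFun (congrFun (congrArg Subtype.val h) 0) 1
      simp [hA] at this
  · intro h
    rcases mk_PSL_two_eq_iff.1 h with h | h
    all_goals
      have h00 := congrFun (congrFun (congrArg Subtype.val h) 0) 0
      have h11 := congrFun (congrFun (congrArg Subtype.val h) 1) 1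
      simp [hB] at h00 h11
    · exact h1 (h00 ▸ h11)
    · exact h1 (h00.symm.trans h11)
  · intro h
    rcases mk_PSL_two_eq_iff.1 h with h | h
    all_goals
      have h := congrArg Subtype.val h
      try rw [Matrix.SpecialLinearGroup.coe_neg] at h
      have h01 := congrFun (congrFun h 0) 1
      have h10 := congrFun (congrFun h 1) 0
      simp [hA, hB, -neg_inj] at h01 h10
      exact h1 (h10.trans h01.symm)

end NoetherBound

namespace NoetherBound

lemma rpow_nine_tenths_pow (n : ℕ) : ((n : ℝ) ^ (0.9 : ℝ)) ^ 10 = (n : ℝ) ^ 9 := by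
  rw [← Real.rpow_natCast, ← Real.rpow_mul (by positivity), ← Real.rpow_natCast]
  norm_num

lemma le_mul_rpow_of_pow_le {a b n : ℕ} (h : a ^ 10 ≤ b ^ 10 * n ^ 9) :
    (a : ℝ) ≤ b * (n : ℝ) ^ (0.9 : ℝ) := by
  refine le_of_pow_le_pow_left₀ (n := 10) (by norm_num) (by positivity) ?_
  rw [mul_pow, rpow_nine_tenths_pow]
  exact_mod_cast h

lemma sq_add_pow_ten_le : ∀ n < 256, 11 ≤ n →
    (n ^ 2 + 6 * n + 3) ^ 10 ≤ (2 * n + 1) ^ 10 * n ^ 9 := by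
  decide +kernel

lemma degree_bound_of_lt {n : ℕ} (hn : 11 ≤ n) (hn' : n < 256) {N c : ℕ}
    (hN : 6 * N + 6 ≤ 6 * (n * (2 + 1)) + (2 * n + 1) * (2 * (2 + 1) * (2 + 2)))
    (hc : c + (N + 1) / (2 * n + 1) ≤ n) :
    ((n * c + N : ℕ) : ℝ) ≤ (2 * n + 1 : ℕ) * (n : ℝ) ^ (0.9 : ℝ) := by
  refine le_trans ?_ (le_mul_rpow_of_pow_le (sq_add_pow_ten_le n hn' hn))
  norm_cast
  set q := (N + 1) / (2 * n + 1) with hq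
  have h1 : N + 1 < (2 * n + 1) * (q + 1) := Nat.lt_mul_div_succ _ (by omega)
  have h2 : q ≤ 5 := by
    refine Nat.lt_succ_iff.1 ((Nat.div_lt_iff_lt_mul (by omega)).2 ?_)
    omega
  have h3 : n * c + n * q ≤ n ^ 2 := by
    rw [← mul_add, sq]
    exact Nat.mul_le_mul_left n hc
  interval_cases q <;> omega

lemma quartic_le_pow_nine {x : ℝ} (hx : 8 / 5 ≤ x) :
    ((x + 2) * (x + 3) * (x + 4) / 6 + 5 / 2) * (x + 1) ≤ x ^ 9 := by
  obtain ⟨s, hs, rfl⟩ : ∃ s, 0 ≤ s ∧ x = 8 / 5 + s := ⟨x - 8 / 5, by linarith, by ring⟩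
  rw [← sub_nonneg]
  ring_nf
  positivity

lemma exists_degree_bound_of_le {n : ℕ} (hn : 256 ≤ n) :
    ∃ j k : ℕ, 0 < j ∧ 2 * n + 1 ≤ j * k + 1 ∧ ∀ N c : ℕ,
      6 * N + 6 ≤ 6 * (j * (k + 1)) + (2 * n + 1) * (k * (k + 1) * (k + 2)) → c ≤ n →
      ((j * c + N : ℕ) : ℝ) ≤ (2 * n + 1 : ℕ) * (n : ℝ) ^ (0.9 : ℝ) := by
  set x : ℝ := (n : ℝ) ^ (0.1 : ℝ) with hx
  have hn0 : (256 : ℝ) ≤ n := by exact_mod_cast hn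
  have hx10 : x ^ 10 = n := by
    rw [hx, ← Real.rpow_natCast, ← Real.rpow_mul (by positivity)]
    norm_num
  have hx9 : (n : ℝ) ^ (0.9 : ℝ) = x ^ 9 := by
    rw [hx, ← Real.rpow_natCast, ← Real.rpow_mul (by positivity)]
    norm_num
  have hx0 : 0 ≤ x := by positivity
  have hx1 : 8 / 5 ≤ x := by
    refine le_of_pow_le_pow_left₀ (n := 10) (by norm_num) hx0 ?_
    rw [hx10]
    norm_num
    linarith
  set k := ⌊x⌋₊ + 2 with hk
  have hk1 : x + 1 ≤ k := by
    rw [hk]; push_cast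
    linarith [Nat.lt_floor_add_one x]
  have hk2 : (k : ℝ) ≤ x + 2 := by
    rw [hk]; push_cast
    linarith [Nat.floor_le hx0]
  refine ⟨2 * n / k + 1, k, Nat.succ_pos _, ?_, ?_⟩
  · have := Nat.lt_mul_div_succ (2 * n) (show 0 < k by omega)
    rw [mul_comm k] at this
    omega
  intro N c hN hc
  set j := 2 * n / k + 1 with hj
  have hj1 : (j : ℝ) ≤ 2 * n / (x + 1) + 1 := by
    rw [hj]; push_cast
    have : ((2 * n / k : ℕ) : ℝ) ≤ 2 * n / k := by
      have := Nat.cast_div_le (α := ℝ) (m := 2 * n) (n := k)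
      push_cast at this
      exact this
    have : (2 * n : ℝ) / k ≤ 2 * n / (x + 1) := by gcongr
    linarith
  rw [hx9]
  have hN' : 6 * (N : ℝ) + 6 ≤ 6 * (j * (k + 1)) + (2 * n + 1) * (k * (k + 1) * (k + 2)) := by
    exact_mod_cast hN
  have hc' : (c : ℝ) ≤ n := by exact_mod_cast hc
  have hjc : (j : ℝ) * c ≤ j * n := by gcongr
  have hquartic := quartic_le_pow_nine hx1
  push_cast
  set K : ℝ := (x + 2) * (x + 3) * (x + 4) / 6 with hK
  have hK' : (k : ℝ) * (k + 1) * (k + 2) ≤ 6 * K := by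
    calc (k : ℝ) * (k + 1) * (k + 2) ≤ (x + 2) * (x + 2 + 1) * (x + 2 + 2) := by gcongr
      _ = 6 * K := by rw [hK]; ring
  have hK0 : 0 ≤ K := by positivity
  have hxn : 4 * (x + 3) ≤ n := by
    have h : (8 / 5 : ℝ) ^ 9 ≤ x ^ 9 := by gcongr
    rw [← hx10, pow_succ]
    nlinarith
  have hKx : K ≤ x ^ 9 := by nlinarith
  have h1 : (j : ℝ) * (n + k + 1) ≤ (2 * n / (x + 1) + 1) * (n + x + 3) := by
    gcongr ?_ * ?_
    linarith
  have h2 : (2 * n / (x + 1) + 1) * (n + x + 3) =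
      2 * n * (n / (x + 1)) + 2 * n * ((x + 3) / (x + 1)) + n + x + 3 := by
    field_simp
    ring
  have h3 : (n : ℝ) / (x + 1) = x ^ 9 - x ^ 9 / (x + 1) := by
    rw [← hx10]
    field_simp
    ring
  have h4 : K + 5 / 2 ≤ x ^ 9 / (x + 1) := by
    rw [le_div_iff₀ (by positivity)]
    exact hquartic
  have h5 : (x + 3) / (x + 1) ≤ 15 / 8 := by
    rw [div_le_iff₀ (by positivity)]
    linarith
  rw [h3] at h2
  nlinarith

theorem decomposableAbove_PSL_two {σ : Type*} {n : ℕ} [Fact (2 * n + 1).Prime]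
    (hn : 11 ≤ n)
    {α : Matrix.ProjectiveSpecialLinearGroup (Fin 2) (ZMod (2 * n + 1)) →*
      (MvPolynomial σ ℂ →ₐ[ℂ] MvPolynomial σ ℂ)} (hα : IsGraded α) :
    DecomposableAbove α ((2 * n + 1 + 1) * ⌊((2 * n + 1 : ℕ) : ℝ) * (n : ℝ) ^ (0.9 : ℝ)⌋₊) := by
  have hp : 2 < 2 * n + 1 := by omega
  have hindex : (borelDatumPSL (2 * n + 1)).u.range.index ≤ n := by
    rw [index_range_u_borelDatumPSL hp]
    omega
  rw [← index_borelPSL (p := 2 * n + 1)]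
  refine DecomposableAbove.of_subgroup hα _ ?_
  by_cases h : n < 256
  · exact (borelDatumPSL (2 * n + 1)).decomposableAbove (fun g => hα g) hindex
      (j := n) (k := 2) (by omega) (by omega)
      fun N c hN hc => Nat.le_floor (degree_bound_of_lt hn h hN hc)
  · obtain ⟨j, k, hj, hkj, hnum⟩ := exists_degree_bound_of_le (not_lt.1 h)
    exact (borelDatumPSL (2 * n + 1)).decomposableAbove (fun g => hα g) hindex hj hkj
      fun N c hN hc => Nat.le_floor (hnum N c hN ((Nat.le_add_right _ _).trans hc))

lemma noetherNumber_PSL_two_le {n : ℕ} [Fact (2 * n + 1).Prime] (hn : 6 ≤ n) :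
    (noetherNumber (Matrix.ProjectiveSpecialLinearGroup (Fin 2) (ZMod (2 * n + 1))) : ℝ) ≤
      (2 * n + 1 + 1) * (2 * n + 1) * (n : ℝ) ^ (0.9 : ℝ) := by
  have hp : 2 < 2 * n + 1 := by omega
  by_cases h : 11 ≤ n
  · refine (Nat.cast_le.2 (noetherNumber_le_of_decomposableAbove fun m ρ =>
      decomposableAbove_PSL_two h (isGraded_polyAction ρ))).trans ?_
    rw [Nat.cast_mul, mul_assoc]
    push_cast
    gcongr
    refine (Nat.floor_le (by positivity)).trans_eq ?_
    rfl
  · obtain ⟨a, b, ha, hb, hab, ha1, hb1, hne⟩ := exists_four_PSL_two hp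
    refine (Nat.cast_le.2 (noetherNumber_le_of_decomposableAbove fun m ρ =>
      decomposableAbove_of_four (isGraded_polyAction ρ) ha hb hab ha1 hb1 hne)).trans ?_
    have hcard := card_PSL_two hp
    have h1 : ((3 * n : ℕ) : ℝ) ≤ (4 : ℕ) * (n : ℝ) ^ (0.9 : ℝ) := by
      refine le_mul_rpow_of_pow_le ?_
      interval_cases n <;> norm_num
    set c := Nat.card (Matrix.ProjectiveSpecialLinearGroup (Fin 2) (ZMod (2 * n + 1)))
    have h2 : c = (2 * n + 1) * (2 * n + 1 + 1) * n := by
      have : 2 * n + 1 - 1 = n * 2 := by omega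
      rw [this, ← mul_assoc] at hcard
      omega
    have h3 : c / 4 * 3 * 4 ≤ (2 * n + 1) * (2 * n + 1 + 1) * n * 3 := by
      rw [← h2]
      omega
    have h4 : ((c / 4 * 3 : ℕ) : ℝ) * 4 ≤ (2 * n + 1) * (2 * n + 1 + 1) * n * 3 := by
      exact_mod_cast h3
    push_cast at h1
    have h5 : (2 * n + 1 + 1) * (2 * n + 1) * (3 * n : ℝ) ≤
        (2 * n + 1 + 1) * (2 * n + 1) * (4 * (n : ℝ) ^ (0.9 : ℝ)) := by gcongr
    linarith

lemma mul_rpow_lt_card_PSL_two_rpow {n : ℕ} [Fact (2 * n + 1).Prime] (hn : 6 ≤ n) :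
    (2 * n + 1 + 1) * (2 * n + 1) * (n : ℝ) ^ (0.9 : ℝ) <
      (Nat.card (Matrix.ProjectiveSpecialLinearGroup (Fin 2) (ZMod (2 * n + 1))) : ℝ) ^
        ((39 : ℝ) / 40) := by
  have hp : 2 < 2 * n + 1 := by omega
  have hcard := card_PSL_two hp
  set c := Nat.card (Matrix.ProjectiveSpecialLinearGroup (Fin 2) (ZMod (2 * n + 1)))
  have h2 : c = (2 * n + 1 + 1) * (2 * n + 1) * n := by
    have : 2 * n + 1 - 1 = n * 2 := by omega
    rw [this, ← mul_assoc, mul_comm (2 * n + 1)] at hcard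
    omega
  rw [h2]
  have h3 : (2 * n + 1 + 1) * (2 * n + 1) < n ^ 3 := by nlinarith
  set m := (2 * n + 1 + 1) * (2 * n + 1) with hm
  have hm' : (2 * (n : ℝ) + 1 + 1) * (2 * n + 1) = m := by rw [hm]; push_cast; ring
  rw [hm']
  have hn0 : (0 : ℝ) < n := by exact_mod_cast (by omega : 0 < n)
  have hm0 : (0 : ℝ) < m := by rw [← hm']; positivity
  push_cast
  rw [Real.mul_rpow hm0.le hn0.le]
  have h4 : (m : ℝ) ^ (1 / 40 : ℝ) < (n : ℝ) ^ (3 / 40 : ℝ) := by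
    have : (n : ℝ) ^ (3 / 40 : ℝ) = ((n ^ 3 : ℕ) : ℝ) ^ (1 / 40 : ℝ) := by
      push_cast
      rw [← Real.rpow_natCast, ← Real.rpow_mul hn0.le]
      norm_num
    rw [this]
    exact Real.rpow_lt_rpow hm0.le (by exact_mod_cast h3) (by norm_num)
  calc (m : ℝ) * (n : ℝ) ^ (0.9 : ℝ)
      = (m : ℝ) ^ (39 / 40 : ℝ) * (n : ℝ) ^ (0.9 : ℝ) * (m : ℝ) ^ (1 / 40 : ℝ) := by
        rw [mul_right_comm, ← Real.rpow_add hm0]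
        norm_num
    _ < (m : ℝ) ^ (39 / 40 : ℝ) * (n : ℝ) ^ (0.9 : ℝ) * (n : ℝ) ^ (3 / 40 : ℝ) := by gcongr
    _ = (m : ℝ) ^ (39 / 40 : ℝ) * (n : ℝ) ^ (39 / 40 : ℝ) := by
        rw [mul_assoc, ← Real.rpow_add hn0]
        norm_num

end NoetherBound

/-- **Bound for `PSL(2,p)`.**  For a prime `p ≥ 13` and `S = PSL(2,p)` we have
`β(S) ≤ (p+1)·p·((p-1)/2)^0.9`, and consequently `β(S) < |S|^(39/40)`. -/
theorem noetherNumber_PSL_two_p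
    (p : ℕ) [Fact p.Prime] (hp : 13 ≤ p) :
    (noetherNumber (Matrix.ProjectiveSpecialLinearGroup (Fin 2) (ZMod p)) : ℝ) ≤
      ((p : ℝ) + 1) * (p : ℝ) * (((p : ℝ) - 1) / 2) ^ (0.9 : ℝ) ∧
    (noetherNumber (Matrix.ProjectiveSpecialLinearGroup (Fin 2) (ZMod p)) : ℝ) <
      (Nat.card (Matrix.ProjectiveSpecialLinearGroup (Fin 2) (ZMod p)) : ℝ) ^
        ((39 : ℝ) / 40) := by
  obtain ⟨n, rfl⟩ := (Fact.out : p.Prime).odd_of_ne_two (by omega)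
  have h := NoetherBound.noetherNumber_PSL_two_le (n := n) (by omega)
  refine ⟨?_, h.trans_lt (NoetherBound.mul_rpow_lt_card_PSL_two_rpow (by omega))⟩
  have h' : (((2 * n + 1 : ℕ) : ℝ) - 1) / 2 = n := by push_cast; ring
  rw [h']
  push_cast
  exact h
end

section
/- Let p be a prime, f ≥ 2 an integer, and q = p^f, and let S = PSL(2, q) be the projective special linear group of 2×2 matrices over the field with q elements. Then n(S) > |S|^{1/15}, i.e., β(S) < |S|^{14/15}. -/
open MvPolynomial

/-- The homogeneous polynomials of degree `m` that are fixed by every `σ g`. -/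
def homogeneousInvariants {ι G : Type*} [Group G]
    (σ : G →* (MvPolynomial ι ℂ →ₐ[ℂ] MvPolynomial ι ℂ)) (m : ℕ) :
    Submodule ℂ (MvPolynomial ι ℂ) where
  carrier := {u | u.IsHomogeneous m ∧ ∀ g, σ g u = u}
  add_mem' := fun hu hv => ⟨hu.1.add hv.1, fun g => by rw [map_add, hu.2, hv.2]⟩
  zero_mem' := ⟨isHomogeneous_zero _ _ _, fun g => map_zero _⟩
  smul_mem' := fun c u hu =>
    ⟨(homogeneousSubmodule ι ℂ m).smul_mem c hu.1, fun g => by rw [map_smul, hu.2]⟩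

/-- A family `I` of submodules, to be thought of as the graded pieces of an algebra, is
decomposable above degree `b` if every piece of degree greater than `b` is spanned by products
of elements of pieces of smaller positive degree. -/
def DecomposableAbove {A : Type*} [CommRing A] [Algebra ℂ A] (I : ℕ → Submodule ℂ A) (b : ℕ) :
    Prop :=
  ∀ m, b < m → I m ≤ Submodule.span ℂ
    {x | ∃ i j, 0 < i ∧ 0 < j ∧ i + j = m ∧ ∃ u ∈ I i, ∃ v ∈ I j, u * v = x}

namespace DecomposableAbove

variable {A : Type*} [CommRing A] [Algebra ℂ A] {I : ℕ → Submodule ℂ A} {b : ℕ}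

theorem le_span_mul (hI : DecomposableAbove I b) (h_one : 1 ∈ I 0)
    (h_mul : ∀ i j, ∀ u ∈ I i, ∀ v ∈ I j, u * v ∈ I (i + j)) (m : ℕ) (hm : 0 < m) :
    I m ≤ Submodule.span ℂ
      {x | ∃ i j, 0 < i ∧ i ≤ b ∧ i + j = m ∧ ∃ u ∈ I i, ∃ v ∈ I j, u * v = x} := by
  induction m using Nat.strong_induction_on with
  | _ m ih =>
    rcases le_or_gt m b with hmb | hmb
    · intro u hu
      exact Submodule.subset_span ⟨m, 0, hm, hmb, rfl, u, hu, 1, h_one, mul_one u⟩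
    · refine (hI m hmb).trans (Submodule.span_le.2 ?_)
      rintro _ ⟨i, j, hi, hj, rfl, u, hu, v, hv, rfl⟩
      have key : Submodule.span ℂ
          {x | ∃ k l, 0 < k ∧ k ≤ b ∧ k + l = i ∧ ∃ u ∈ I k, ∃ v ∈ I l, u * v = x} ≤
          (Submodule.span ℂ {x | ∃ k l, 0 < k ∧ k ≤ b ∧ k + l = i + j ∧
            ∃ u ∈ I k, ∃ v ∈ I l, u * v = x}).comap (LinearMap.mulRight ℂ v) := by
        refine Submodule.span_le.2 ?_
        rintro _ ⟨k, l, hk, hkb, rfl, u', hu', v', hv', rfl⟩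
        exact Submodule.subset_span ⟨k, l + j, hk, hkb, by omega, u', hu', v' * v,
          h_mul _ _ _ hv' _ hv, by simp [mul_assoc]⟩
      exact key (ih i (by omega) hi hu)

theorem le_span_prod_mul {κ : Type*} (hI : DecomposableAbove I b) (h_one : 1 ∈ I 0)
    (h_mul : ∀ i j, ∀ u ∈ I i, ∀ v ∈ I j, u * v ∈ I (i + j)) (s : Finset κ) :
    ∀ m, s.card * b < m → I m ≤ Submodule.span ℂ
      {x | ∃ (d : κ → ℕ) (u : κ → A) (e : ℕ), (∀ i ∈ s, 0 < d i) ∧ (∀ i ∈ s, u i ∈ I (d i)) ∧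
        0 < e ∧ ∑ i ∈ s, d i + e = m ∧ ∃ v ∈ I e, (∏ i ∈ s, u i) * v = x} := by
  classical
  induction s using Finset.induction_on with
  | empty =>
    intro m hm u hu
    exact Submodule.subset_span ⟨fun _ => 0, fun _ => 0, m, by simp, by simp, by omega, by simp,
      u, hu, by simp⟩
  | insert a s ha ih =>
    intro m hm
    rw [Finset.card_insert_of_notMem ha, add_mul, one_mul] at hm
    refine (hI.le_span_mul h_one h_mul m (by omega)).trans (Submodule.span_le.2 ?_)
    rintro _ ⟨i, j, hi, hib, rfl, u, hu, v, hv, rfl⟩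
    have key : Submodule.span ℂ
      {x | ∃ (d : κ → ℕ) (u : κ → A) (e : ℕ), (∀ i ∈ s, 0 < d i) ∧ (∀ i ∈ s, u i ∈ I (d i)) ∧
        0 < e ∧ ∑ i ∈ s, d i + e = j ∧ ∃ v ∈ I e, (∏ i ∈ s, u i) * v = x} ≤
      (Submodule.span ℂ {x | ∃ (d : κ → ℕ) (u : κ → A) (e : ℕ), (∀ i ∈ insert a s, 0 < d i) ∧
        (∀ i ∈ insert a s, u i ∈ I (d i)) ∧ 0 < e ∧ ∑ i ∈ insert a s, d i + e = i + j ∧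
        ∃ v ∈ I e, (∏ i ∈ insert a s, u i) * v = x}).comap (LinearMap.mulLeft ℂ u) := by
      refine Submodule.span_le.2 ?_
      rintro _ ⟨d, u', e, hd, hu', he, rfl, v', hv', rfl⟩
      have hne : ∀ k ∈ s, k ≠ a := fun k hk h => ha (h ▸ hk)
      refine Submodule.subset_span ⟨Function.update d a i, Function.update u' a u, e, ?_, ?_, he,
        ?_, v', hv', ?_⟩
      · simp only [Finset.forall_mem_insert, Function.update_self]
        exact ⟨hi, fun k hk => by simpa [hne k hk] using hd k hk⟩
      · simp only [Finset.forall_mem_insert, Function.update_self]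
        exact ⟨hu, fun k hk => by simpa [hne k hk] using hu' k hk⟩
      · rw [Finset.sum_insert ha, Function.update_self, Finset.sum_update_of_notMem ha]
        omega
      · rw [Finset.prod_insert ha, Function.update_self, Finset.prod_update_of_notMem ha]
        simp [mul_assoc]
    exact key (ih j (by omega) hv)

end DecomposableAbove

section Invariants

variable {ι G : Type*} [Group G] {σ : G →* (MvPolynomial ι ℂ →ₐ[ℂ] MvPolynomial ι ℂ)}

theorem one_mem_homogeneousInvariants : 1 ∈ homogeneousInvariants σ 0 :=
  ⟨isHomogeneous_one _ _, fun _ => map_one _⟩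

theorem mul_mem_homogeneousInvariants (i j : ℕ) (u : MvPolynomial ι ℂ)
    (hu : u ∈ homogeneousInvariants σ i) (v : MvPolynomial ι ℂ)
    (hv : v ∈ homogeneousInvariants σ j) : u * v ∈ homogeneousInvariants σ (i + j) :=
  ⟨hu.1.mul hv.1, fun g => by rw [map_mul, hu.2, hv.2]⟩

theorem prod_mem_homogeneousInvariants {κ : Type*} (s : Finset κ) (d : κ → ℕ)
    (u : κ → MvPolynomial ι ℂ) (hu : ∀ i ∈ s, u i ∈ homogeneousInvariants σ (d i)) :
    ∏ i ∈ s, u i ∈ homogeneousInvariants σ (∑ i ∈ s, d i) :=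
  ⟨IsHomogeneous.prod s u d fun i hi => (hu i hi).1,
    fun g => by rw [map_prod]; exact Finset.prod_congr rfl fun i hi => (hu i hi).2 g⟩

/-- The transfer map `u ↦ ∑ g, σ g u`. -/
noncomputable def transfer [Fintype G] (σ : G →* (MvPolynomial ι ℂ →ₐ[ℂ] MvPolynomial ι ℂ)) :
    MvPolynomial ι ℂ →ₗ[ℂ] MvPolynomial ι ℂ :=
  ∑ g, (σ g).toLinearMap

theorem transfer_apply [Fintype G] (u : MvPolynomial ι ℂ) : transfer σ u = ∑ g, σ g u := by
  simp [transfer]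

theorem transfer_mem_homogeneousInvariants [Fintype G]
    (hσ : ∀ g m (u : MvPolynomial ι ℂ), u.IsHomogeneous m → (σ g u).IsHomogeneous m)
    {m : ℕ} {u : MvPolynomial ι ℂ} (hu : u.IsHomogeneous m) :
    transfer σ u ∈ homogeneousInvariants σ m := by
  rw [transfer_apply]
  refine ⟨IsHomogeneous.sum _ _ _ fun g _ => hσ g m u hu, fun g => ?_⟩
  rw [map_sum]
  exact Fintype.sum_equiv (Equiv.mulLeft g) _ _ fun h => by simp [map_mul]

theorem transfer_mul_of_invariant [Fintype G] {t u : MvPolynomial ι ℂ}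
    (ht : ∀ g, σ g t = t) : transfer σ (t * u) = t * transfer σ u := by
  simp [transfer_apply, ht, Finset.mul_sum]

theorem transfer_of_invariant [Fintype G] {t : MvPolynomial ι ℂ}
    (ht : ∀ g, σ g t = t) : transfer σ t = (Fintype.card G : ℂ) • t := by
  simp [transfer_apply, ht, Nat.cast_smul_eq_nsmul]

/-- A relative version of Benson's identity. -/
theorem sum_transfer_mul_prod_eq_zero [Fintype G] (H : Subgroup G) [Fintype (G ⧸ H)]
    [DecidableEq (G ⧸ H)]
    (u : G ⧸ H → MvPolynomial ι ℂ) (hu : ∀ i, ∀ h ∈ H, σ h (u i) = u i) :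
    ∑ t : Finset (G ⧸ H), transfer σ (∏ i ∈ t, σ i.out (u i)) *
      ∏ i ∈ Finset.univ \ t, (-u i) = 0 := by
  have h0 : ∀ g : G, ∏ i : G ⧸ H, (σ g (σ i.out (u i)) + -u i) = 0 := by
    intro g
    refine Finset.prod_eq_zero (Finset.mem_univ ((g⁻¹ : G) : G ⧸ H)) ?_
    have hmem : g * ((g⁻¹ : G) : G ⧸ H).out ∈ H := by
      have := QuotientGroup.eq.1 (QuotientGroup.out_eq' ((g⁻¹ : G) : G ⧸ H)).symm
      simpa using this
    have := hu ((g⁻¹ : G) : G ⧸ H) _ hmem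
    rw [map_mul] at this
    rw [show σ g (σ ((g⁻¹ : G) : G ⧸ H).out (u _)) = u _ from this, add_neg_cancel]
  calc _ = ∑ g : G, ∏ i : G ⧸ H, (σ g (σ i.out (u i)) + -u i) := by
        simp_rw [Finset.prod_add, Finset.powerset_univ, transfer_apply, Finset.sum_mul]
        rw [Finset.sum_comm]
        simp only [map_prod]
    _ = 0 := Finset.sum_eq_zero fun g _ => h0 g

theorem DecomposableAbove.of_subgroup [Finite G]
    (hσ : ∀ g m (u : MvPolynomial ι ℂ), u.IsHomogeneous m → (σ g u).IsHomogeneous m)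
    (H : Subgroup G) {b : ℕ}
    (hH : DecomposableAbove (homogeneousInvariants (σ.comp H.subtype)) b) :
    DecomposableAbove (homogeneousInvariants σ) (H.index * b) := by
  classical
  have := Fintype.ofFinite G
  have := Fintype.ofFinite (G ⧸ H)
  intro m hm
  set W := Submodule.span ℂ {x | ∃ i j, 0 < i ∧ 0 < j ∧ i + j = m ∧
    ∃ u ∈ homogeneousInvariants σ i, ∃ v ∈ homogeneousInvariants σ j, u * v = x}
  have hG : (Fintype.card G : ℂ) ≠ 0 := Nat.cast_ne_zero.2 Fintype.card_ne_zero
  have key : homogeneousInvariants (σ.comp H.subtype) m ≤ W.comap (transfer σ) := by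
    have hcard : (Finset.univ : Finset (G ⧸ H)).card * b < m := by
      rwa [Finset.card_univ, ← Nat.card_eq_fintype_card, ← Subgroup.index]
    refine (hH.le_span_prod_mul one_mem_homogeneousInvariants mul_mem_homogeneousInvariants
      Finset.univ m hcard).trans (Submodule.span_le.2 ?_)
    rintro _ ⟨d, u, e, hd, hu, he, rfl, v, hv, rfl⟩
    have hid := sum_transfer_mul_prod_eq_zero (σ := σ) H u
      fun i h hh => (hu i (Finset.mem_univ i)).2 ⟨h, hh⟩
    rw [← Finset.add_sum_erase _ _ (Finset.mem_univ ∅)] at hid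
    have hid2 : ((Fintype.card G : ℂ) * (-1) ^ Fintype.card (G ⧸ H)) •
        transfer σ ((∏ i, u i) * v) =
        - ∑ t ∈ Finset.univ.erase (∅ : Finset (G ⧸ H)),
          transfer σ (∏ i ∈ t, σ i.out (u i)) *
            transfer σ ((∏ i ∈ Finset.univ \ t, (-u i)) * v) := by
      rw [← map_smul]
      have h1 : ((Fintype.card G : ℂ) * (-1) ^ Fintype.card (G ⧸ H)) • ((∏ i, u i) * v) =
          - ∑ t ∈ Finset.univ.erase (∅ : Finset (G ⧸ H)),
          transfer σ (∏ i ∈ t, σ i.out (u i)) *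
            ((∏ i ∈ Finset.univ \ t, (-u i)) * v) := by
        simp_rw [← mul_assoc]
        rw [← Finset.sum_mul, ← neg_mul, ← eq_neg_of_add_eq_zero_left hid]
        simp only [Finset.prod_empty, Finset.sdiff_empty, Finset.prod_neg, Finset.card_univ]
        rw [transfer_of_invariant fun g => map_one _]
        simp only [Algebra.smul_def, map_mul, map_pow, map_neg, map_one]
        ring
      rw [h1, map_neg, map_sum]
      congr 1
      refine Finset.sum_congr rfl fun t _ => transfer_mul_of_invariant ?_
      exact (transfer_mem_homogeneousInvariants hσ (IsHomogeneous.prod _ _ d fun i _ =>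
        hσ _ _ _ (hu i (Finset.mem_univ i)).1)).2
    have hc : ((Fintype.card G : ℂ) * (-1) ^ Fintype.card (G ⧸ H)) ≠ 0 :=
      mul_ne_zero hG (pow_ne_zero _ (neg_ne_zero.2 one_ne_zero))
    rw [SetLike.mem_coe, Submodule.mem_comap, ← W.smul_mem_iff hc, hid2]
    refine W.neg_mem (W.sum_mem fun t ht => Submodule.subset_span
      ⟨∑ i ∈ t, d i, ∑ i ∈ Finset.univ \ t, d i + e, ?_, by omega, ?_, _,
        transfer_mem_homogeneousInvariants hσ (IsHomogeneous.prod _ _ d fun i _ =>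
          hσ _ _ _ (hu i (Finset.mem_univ i)).1), _,
        transfer_mem_homogeneousInvariants hσ ((IsHomogeneous.prod _ _ d fun i _ =>
          (hu i (Finset.mem_univ i)).1.neg).mul hv.1), rfl⟩)
    · exact Finset.sum_pos (fun i _ => hd i (Finset.mem_univ i))
        (Finset.nonempty_iff_ne_empty.2 (Finset.mem_erase.1 ht).1)
    · rw [← Finset.sum_sdiff (Finset.subset_univ t)]
      omega
  intro u hu
  have hu' : u ∈ homogeneousInvariants (σ.comp H.subtype) m := ⟨hu.1, fun h => hu.2 h⟩
  have := key hu'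
  rwa [Submodule.mem_comap, transfer_of_invariant hu.2, W.smul_mem_iff hG] at this

end Invariants

/-- A version of Olson's theorem on the Davenport constant of an elementary abelian `p`-group. -/
theorem exists_nonempty_subset_sum_eq_zero {p : ℕ} [Fact p.Prime] {V κ : Type*} [AddCommGroup V]
    [Module (ZMod p) V] [FiniteDimensional (ZMod p) V] (a : κ → V) (s : Finset κ)
    (hs : Module.finrank (ZMod p) V * (p - 1) < s.card) :
    ∃ t ⊆ s, t.Nonempty ∧ ∑ i ∈ t, a i = 0 := by
  classical
  let B := Module.finBasis (ZMod p) V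
  let P : Fin (Module.finrank (ZMod p) V) → MvPolynomial s (ZMod p) :=
    fun j => ∑ i : s, B.repr (a i) j • X i ^ (p - 1)
  have hp : p.Prime := Fact.out
  have hdeg : ∑ j, (P j).totalDegree < Fintype.card s := by
    refine lt_of_le_of_lt (Finset.sum_le_card_nsmul _ _ (p - 1) fun j _ => ?_) (by simpa using hs)
    refine totalDegree_finsetSum_le fun i _ => ?_
    exact (totalDegree_smul_le ..).trans (totalDegree_X_pow ..).le
  let z : {x : s → ZMod p // ∀ j, eval x (P j) = 0} :=
    ⟨0, by simp [P, (Nat.sub_pos_of_lt hp.one_lt).ne']⟩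
  have hdvd : p ∣ Fintype.card {x : s → ZMod p // ∀ j, eval x (P j) = 0} := by
    convert char_dvd_card_solutions_of_fintype_sum_lt p hdeg
  obtain ⟨x, hx⟩ := Fintype.exists_ne_of_one_lt_card
    (hp.one_lt.trans_le (Nat.le_of_dvd (Fintype.card_pos_iff.2 ⟨z⟩) hdvd)) z
  refine ⟨({i | x.1 i ≠ 0} : Finset s).map ⟨(↑), Subtype.val_injective⟩, ?_, ?_, ?_⟩
  · simp +contextual [Finset.subset_iff]
  · rw [← Subtype.coe_ne_coe, Function.ne_iff] at hx
    obtain ⟨i, hi⟩ := hx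
    exact ⟨i, by simpa [z] using hi⟩
  · refine B.ext_elem fun j => ?_
    have := x.2 j
    simpa [P, ZMod.pow_card_sub_one, Finset.sum_filter, apply_ite B.repr, ite_apply,
      apply_ite (fun v : _ →₀ ZMod p => v j)] using this

section Weights

variable {ι K : Type*} [Field K]

/-- The homogeneous polynomials of degree `m` on which the action `τ` of the additive group of
`K` is given by the character `x ↦ ψ (x * a)`. -/
def homogeneousWeightSpace
    (τ : Multiplicative K →* (MvPolynomial ι ℂ →ₐ[ℂ] MvPolynomial ι ℂ)) (ψ : AddChar K ℂ)
    (m : ℕ) (a : K) : Submodule ℂ (MvPolynomial ι ℂ) where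
  carrier := {u | u.IsHomogeneous m ∧ ∀ x, τ (Multiplicative.ofAdd x) u = ψ (x * a) • u}
  add_mem' := fun hu hv => ⟨hu.1.add hv.1, fun g => by rw [map_add, hu.2, hv.2, smul_add]⟩
  zero_mem' := ⟨isHomogeneous_zero _ _ _, fun g => by rw [map_zero, smul_zero]⟩
  smul_mem' := fun c u hu =>
    ⟨(homogeneousSubmodule ι ℂ m).smul_mem c hu.1, fun g => by rw [map_smul, hu.2, smul_comm]⟩

variable {τ : Multiplicative K →* (MvPolynomial ι ℂ →ₐ[ℂ] MvPolynomial ι ℂ)} {ψ : AddChar K ℂ}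

theorem homogeneousWeightSpace_zero_le (m : ℕ) :
    homogeneousWeightSpace τ ψ m 0 ≤ homogeneousInvariants τ m :=
  fun _ hu => ⟨hu.1, fun g => by simpa using hu.2 g.toAdd⟩

theorem prod_mem_homogeneousWeightSpace {κ : Type*} (s : Finset κ) (a : κ → K)
    (u : κ → MvPolynomial ι ℂ) (hu : ∀ i, u i ∈ homogeneousWeightSpace τ ψ 1 (a i)) :
    ∏ i ∈ s, u i ∈ homogeneousWeightSpace τ ψ s.card (∑ i ∈ s, a i) := by
  refine ⟨by simpa using IsHomogeneous.prod s u (fun _ => 1) fun i _ => (hu i).1, fun x => ?_⟩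
  have hψ : ψ (x * ∑ i ∈ s, a i) = ∏ i ∈ s, ψ (x * a i) := by
    rw [Finset.mul_sum]
    exact map_prod ψ.toMonoidHom (fun i => Multiplicative.ofAdd (x * a i)) s
  rw [map_prod, hψ, ← Finset.prod_smul]
  exact Finset.prod_congr rfl fun i _ => (hu i).2 x

variable [Fintype K]

theorem homogeneousSubmodule_le_span_weightVectors
    (hτ : ∀ g m (u : MvPolynomial ι ℂ), u.IsHomogeneous m → (τ g u).IsHomogeneous m)
    (hψ : ψ.IsPrimitive) :
    homogeneousSubmodule ι ℂ 1 ≤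
      Submodule.span ℂ {u | ∃ a, u ∈ homogeneousWeightSpace τ ψ 1 a} := by
  classical
  intro u hu
  have hK : (Fintype.card K : ℂ) ≠ 0 := Nat.cast_ne_zero.2 Fintype.card_ne_zero
  rw [← Submodule.smul_mem_iff _ hK]
  have h1 : (Fintype.card K : ℂ) • u =
      ∑ a : K, ∑ x : K, ψ (a * -x) • τ (Multiplicative.ofAdd x) u := by
    rw [Finset.sum_comm]
    simp_rw [← Finset.sum_smul, AddChar.sum_mulShift _ hψ, neg_eq_zero]
    simp
  rw [h1]
  refine Submodule.sum_mem _ fun a _ => Submodule.subset_span ⟨a, ?_, fun y => ?_⟩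
  · exact IsHomogeneous.sum _ _ _ fun x _ =>
      (homogeneousSubmodule ι ℂ 1).smul_mem _ (hτ _ _ _ hu)
  · rw [map_sum, Finset.smul_sum]
    refine Fintype.sum_equiv (Equiv.addLeft y) _ _ fun x => ?_
    rw [map_smul, Equiv.coe_addLeft, ofAdd_add, map_mul τ, AlgHom.mul_apply, smul_smul,
      ← AddChar.map_add_eq_mul]
    congr 2
    ring

theorem decomposableAbove_of_finrank {p : ℕ} [Fact p.Prime] [Algebra (ZMod p) K]
    (hτ : ∀ g m (u : MvPolynomial ι ℂ), u.IsHomogeneous m → (τ g u).IsHomogeneous m) :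
    DecomposableAbove (homogeneousInvariants τ) (Module.finrank (ZMod p) K * (p - 1) + 1) := by
  classical
  obtain ⟨ψ, hψ⟩ : ∃ ψ : AddChar K ℂ, ψ.IsPrimitive :=
    ⟨_, AddChar.FiniteField.primitiveChar_to_Complex_isPrimitive K⟩
  intro m hm
  set W := Submodule.span ℂ {x | ∃ i j, 0 < i ∧ 0 < j ∧ i + j = m ∧
    ∃ u ∈ homogeneousInvariants τ i, ∃ v ∈ homogeneousInvariants τ j, u * v = x}
  have hK : (Fintype.card (Multiplicative K) : ℂ) ≠ 0 := Nat.cast_ne_zero.2 Fintype.card_ne_zero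
  have key : homogeneousSubmodule ι ℂ m ≤ W.comap (transfer τ) := by
    rw [← homogeneousSubmodule_one_pow]
    refine (pow_le_pow_left'
      (homogeneousSubmodule_le_span_weightVectors hτ hψ) m).trans ?_
    rw [Submodule.span_pow, Submodule.span_le]
    intro x hx
    obtain ⟨l, rfl⟩ := Set.mem_pow.1 hx
    choose a ha using fun i => (l i).2
    rw [List.prod_ofFn, SetLike.mem_coe, Submodule.mem_comap]
    have hl : ∀ s : Finset (Fin m), ∏ i ∈ s, (l i : MvPolynomial ι ℂ) ∈
        homogeneousWeightSpace τ ψ s.card (∑ i ∈ s, a i) := fun s =>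
      prod_mem_homogeneousWeightSpace s a (fun i => (l i : MvPolynomial ι ℂ)) ha
    by_cases hsum : ∑ i, a i = 0
    · obtain ⟨t, hts, htne, ht⟩ := exists_nonempty_subset_sum_eq_zero (p := p) a
        (Finset.univ.erase (⟨0, by omega⟩ : Fin m))
        (by rw [Finset.card_erase_of_mem (Finset.mem_univ _), Finset.card_fin]; omega)
      have hcard : (Finset.univ \ t).card + t.card = m := by
        rw [Finset.card_sdiff_add_card_eq_card (Finset.subset_univ t), Finset.card_fin]
      have hlt : t.card < m := by
        have := Finset.card_le_card hts
        rw [Finset.card_erase_of_mem (Finset.mem_univ _), Finset.card_fin] at this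
        omega
      have hsdiff : ∑ i ∈ Finset.univ \ t, a i = 0 := by
        rw [← Finset.sum_sdiff (Finset.subset_univ t), ht, add_zero] at hsum
        exact hsum
      have h0 := homogeneousWeightSpace_zero_le _ (hsum ▸ hl Finset.univ)
      rw [transfer_of_invariant h0.2]
      refine W.smul_mem _ (Submodule.subset_span ⟨_, _, ?_, htne.card_pos, hcard, _,
        homogeneousWeightSpace_zero_le _ (hsdiff ▸ hl (Finset.univ \ t)), _,
        homogeneousWeightSpace_zero_le _ (ht ▸ hl t),
        Finset.prod_sdiff (Finset.subset_univ t)⟩)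
      omega
    · have h0 : transfer τ (∏ i, (l i : MvPolynomial ι ℂ)) = 0 := by
        rw [transfer_apply, ← Equiv.sum_comp Multiplicative.ofAdd]
        simp_rw [(hl Finset.univ).2, ← Finset.sum_smul, AddChar.sum_mulShift _ hψ, if_neg hsum]
        simp
      rw [h0]
      exact W.zero_mem
  intro u hu
  have := key hu.1
  rwa [Submodule.mem_comap, transfer_of_invariant hu.2, W.smul_mem_iff hK] at this

end Weights

namespace Representation

variable {G : Type*} [Group G] {n : ℕ} (ρ : Representation ℂ G (Fin n → ℂ))

theorem polySubst_mul (g h : G) :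
    ρ.polySubst (g * h) = (ρ.polySubst h).comp (ρ.polySubst g) := by
  refine MvPolynomial.algHom_ext fun i => ?_
  simp only [polySubst, aeval_X, AlgHom.comp_apply, map_sum, map_mul, LinearMap.toMatrix'_mul,
    Matrix.mul_apply, Finset.sum_mul, Finset.mul_sum, ← MvPolynomial.algebraMap_eq,
    AlgHom.commutes]
  rw [Finset.sum_comm]
  simp only [mul_assoc]

theorem polySubst_one : ρ.polySubst 1 = AlgHom.id ℂ _ := by
  refine MvPolynomial.algHom_ext fun i => ?_
  simp [polySubst, Pi.single_apply, apply_ite C, ite_mul]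

/-- The left action of `G` on the polynomial ring. -/
noncomputable def polyAction : G →* (MvPolynomial (Fin n) ℂ →ₐ[ℂ] MvPolynomial (Fin n) ℂ) where
  toFun g := ρ.polySubst g⁻¹
  map_one' := by rw [inv_one, polySubst_one]; rfl
  map_mul' g h := by rw [mul_inv_rev, polySubst_mul]; rfl

theorem isHomogeneous_polyAction (g : G) (m : ℕ) (u : MvPolynomial (Fin n) ℂ)
    (hu : u.IsHomogeneous m) : (ρ.polyAction g u).IsHomogeneous m := by
  have := hu.aeval (fun i => ∑ j, C (LinearMap.toMatrix' (ρ g⁻¹) i j) * X j) (n := 1)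
    fun i => IsHomogeneous.sum _ _ _ fun j _ => isHomogeneous_C_mul_X _ _
  rwa [one_mul] at this

theorem mem_invariantAlgebra_iff {u : MvPolynomial (Fin n) ℂ} :
    u ∈ ρ.invariantAlgebra ↔ ∀ g, ρ.polyAction g u = u := by
  simp only [invariantAlgebra, Algebra.mem_iInf, AlgHom.mem_equalizer, AlgHom.id_apply]
  exact ⟨fun h g => h g⁻¹, fun h g => by simpa [polyAction] using h g⁻¹⟩

theorem homogeneousComponent_polyAction (g : G) (m : ℕ) (u : MvPolynomial (Fin n) ℂ) :
    homogeneousComponent m (ρ.polyAction g u) = ρ.polyAction g (homogeneousComponent m u) := by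
  induction u using MvPolynomial.induction_on' with
  | monomial s c =>
    have h := isHomogeneous_monomial (σ := Fin n) c (rfl : s.degree = s.degree)
    rw [homogeneousComponent_of_mem h,
      homogeneousComponent_of_mem (ρ.isHomogeneous_polyAction g _ _ h)]
    split_ifs <;> simp
  | add p q hp hq => simp only [map_add, hp, hq]

theorem invariantsGeneratedInDegree_of_decomposableAbove {b : ℕ}
    (h : DecomposableAbove (homogeneousInvariants ρ.polyAction) b) :
    ρ.InvariantsGeneratedInDegree b := by
  set B := Algebra.adjoin ℂ
    {u : MvPolynomial (Fin n) ℂ | u ∈ ρ.invariantAlgebra ∧ u.totalDegree ≤ b}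
  have key : ∀ m, homogeneousInvariants ρ.polyAction m ≤ Subalgebra.toSubmodule B := by
    intro m
    induction m using Nat.strong_induction_on with
    | _ m ih =>
      rcases le_or_gt m b with hmb | hmb
      · intro u hu
        exact Algebra.subset_adjoin
          ⟨ρ.mem_invariantAlgebra_iff.2 hu.2, hu.1.totalDegree_le.trans hmb⟩
      · refine (h m hmb).trans (Submodule.span_le.2 ?_)
        rintro _ ⟨i, j, hi, hj, rfl, u, hu, v, hv, rfl⟩
        exact B.mul_mem (ih i (by omega) hu) (ih j (by omega) hv)
  refine le_antisymm (Algebra.adjoin_le fun u hu => hu.1) fun u hu => ?_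
  rw [← sum_homogeneousComponent u]
  refine B.sum_mem fun m _ => key m ⟨homogeneousComponent_isHomogeneous m u, fun g => ?_⟩
  rw [← homogeneousComponent_polyAction, ρ.mem_invariantAlgebra_iff.1 hu g]

theorem not_invariantsGeneratedInDegree_zero :
    ¬ (1 : Representation ℂ G (Fin 1 → ℂ)).InvariantsGeneratedInDegree 0 := by
  intro h
  have hX : (X 0 : MvPolynomial (Fin 1) ℂ) ∈
      (1 : Representation ℂ G (Fin 1 → ℂ)).invariantAlgebra := by
    rw [mem_invariantAlgebra_iff]
    intro g
    simp [polyAction, polySubst]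
  rw [← h] at hX
  have hle : Algebra.adjoin ℂ {u : MvPolynomial (Fin 1) ℂ |
      u ∈ (1 : Representation ℂ G (Fin 1 → ℂ)).invariantAlgebra ∧ u.totalDegree ≤ 0} ≤ ⊥ := by
    refine Algebra.adjoin_le fun u hu => ?_
    exact Algebra.mem_bot.2 ⟨_, (totalDegree_eq_zero_iff_eq_C.1 (Nat.le_zero.1 hu.2)).symm⟩
  obtain ⟨c, hc⟩ := Algebra.mem_bot.1 (hle hX)
  have := congrArg totalDegree hc
  simp [MvPolynomial.algebraMap_eq] at this

end Representation

theorem noetherNumber_le_of_forall {G : Type*} [Group G] {d : ℕ}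
    (h : ∀ (n : ℕ) (ρ : Representation ℂ G (Fin n → ℂ)),
      DecomposableAbove (homogeneousInvariants ρ.polyAction) d) :
    noetherNumber G ≤ d :=
  Nat.sInf_le fun n ρ => ρ.invariantsGeneratedInDegree_of_decomposableAbove (h n ρ)

theorem noetherNumber_pos_of_forall {G : Type*} [Group G] {d : ℕ}
    (h : ∀ (n : ℕ) (ρ : Representation ℂ G (Fin n → ℂ)),
      DecomposableAbove (homogeneousInvariants ρ.polyAction) d) :
    0 < noetherNumber G := by
  refine Nat.pos_of_ne_zero fun h0 => ?_
  have := Nat.sInf_mem (s := {d : ℕ | ∀ (n : ℕ) (ρ : Representation ℂ G (Fin n → ℂ)),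
    ρ.InvariantsGeneratedInDegree d})
    ⟨d, fun n ρ => ρ.invariantsGeneratedInDegree_of_decomposableAbove (h n ρ)⟩
  rw [← noetherNumber, h0] at this
  exact Representation.not_invariantsGeneratedInDegree_zero (this 1 1)

theorem noetherNumber_bounds_of_injective {G K : Type*} [Group G] [Finite G] [Field K] [Finite K]
    {p : ℕ} [Fact p.Prime] [Algebra (ZMod p) K] (φ : Multiplicative K →* G)
    (hφ : Function.Injective φ) :
    0 < noetherNumber G ∧ noetherNumber G * Nat.card K ≤
      Nat.card G * (Module.finrank (ZMod p) K * (p - 1) + 1) := by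
  have := Fintype.ofFinite K
  have hdec : ∀ (n : ℕ) (ρ : Representation ℂ G (Fin n → ℂ)),
      DecomposableAbove (homogeneousInvariants ρ.polyAction)
        (φ.range.index * (Module.finrank (ZMod p) K * (p - 1) + 1)) := by
    intro n ρ
    refine DecomposableAbove.of_subgroup ρ.isHomogeneous_polyAction φ.range ?_
    have heq : homogeneousInvariants (ρ.polyAction.comp φ.range.subtype) =
        homogeneousInvariants (ρ.polyAction.comp φ) := by
      ext m u
      exact and_congr_right fun _ => ⟨fun h x => h ⟨φ x, x, rfl⟩,
        by rintro h ⟨_, x, rfl⟩; exact h x⟩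
    rw [heq]
    exact decomposableAbove_of_finrank fun g => ρ.isHomogeneous_polyAction (φ g)
  refine ⟨noetherNumber_pos_of_forall hdec, ?_⟩
  have hcard : Nat.card φ.range = Nat.card K :=
    (Nat.card_congr (Equiv.ofInjective φ hφ)).symm
  calc noetherNumber G * Nat.card K
      ≤ φ.range.index * (Module.finrank (ZMod p) K * (p - 1) + 1) * Nat.card K :=
        Nat.mul_le_mul_right _ (noetherNumber_le_of_forall hdec)
    _ = Nat.card G * (Module.finrank (ZMod p) K * (p - 1) + 1) := by
        rw [← φ.range.index_mul_card, hcard]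
        ring

namespace Matrix

variable (K : Type*) [Field K]

/-- The upper unitriangular matrices as a homomorphism into `SL(2, K)`. -/
def SpecialLinearGroup.upperUnipotent : Multiplicative K →* SpecialLinearGroup (Fin 2) K where
  toFun x := ⟨!![1, x.toAdd; 0, 1], by simp [Matrix.det_fin_two]⟩
  map_one' := by
    ext i j
    fin_cases i <;> fin_cases j <;> simp
  map_mul' x y := Subtype.ext <| by
    change !![1, (x * y).toAdd; 0, 1] = !![1, x.toAdd; 0, 1] * !![1, y.toAdd; 0, 1]
    simp [add_comm]

theorem SpecialLinearGroup.coe_upperUnipotent (x : Multiplicative K) :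
    (SpecialLinearGroup.upperUnipotent K x : Matrix (Fin 2) (Fin 2) K) = !![1, x.toAdd; 0, 1] :=
  rfl

theorem ProjectiveSpecialLinearGroup.upperUnipotent_injective :
    Function.Injective ((QuotientGroup.mk' (Subgroup.center (SpecialLinearGroup (Fin 2) K))).comp
      (SpecialLinearGroup.upperUnipotent K)) := by
  rw [injective_iff_map_eq_one]
  intro x hx
  have hc : SpecialLinearGroup.upperUnipotent K x ∈
      Subgroup.center (SpecialLinearGroup (Fin 2) K) := (QuotientGroup.eq_one_iff _).1 hx
  have h := SpecialLinearGroup.scalar_eq_self_of_mem_center hc 0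
  have h01 := congrFun (congrFun h 0) 1
  rw [SpecialLinearGroup.coe_upperUnipotent] at h01
  have h0 : x.toAdd = 0 := by simpa using h01.symm
  exact h0

theorem SpecialLinearGroup.card_fin_two_le [Finite K] :
    Nat.card (SpecialLinearGroup (Fin 2) K) ≤ Nat.card K ^ 3 := by
  classical
  have hinj : Function.Injective fun M : SpecialLinearGroup (Fin 2) K =>
      (M 0 0, M 0 1, if M 0 0 = 0 then M 1 1 else M 1 0) := by
    intro M N h
    have hM := M.det_coe
    have hN := N.det_coe
    rw [Matrix.det_fin_two] at hM hN
    obtain ⟨h00, h01, h1⟩ : M 0 0 = N 0 0 ∧ M 0 1 = N 0 1 ∧ _ := by simpa using h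
    rw [h00, h01] at hM
    rw [h00] at h1
    have hrow : M 1 0 = N 1 0 ∧ M 1 1 = N 1 1 := by
      by_cases h0 : N 0 0 = 0
      · simp only [h0, if_true] at h1
        refine ⟨?_, h1⟩
        have hne : N 0 1 ≠ 0 := by
          intro h2
          simp [h0, h2] at hN
        refine mul_left_cancel₀ hne ?_
        rw [h1] at hM
        linear_combination hN - hM
      · simp only [h0, if_false] at h1
        refine ⟨h1, mul_left_cancel₀ h0 ?_⟩
        rw [h1] at hM
        linear_combination hM - hN
    ext i j
    fin_cases i <;> fin_cases j <;> simp [h00, h01, hrow]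
  refine (Nat.card_le_card_of_injective _ hinj).trans_eq ?_
  simp only [Nat.card_prod]
  ring

end Matrix

theorem pow_five_lt_pow_four_mul {p f : ℕ} (hp : 2 ≤ p) (hf : 2 ≤ f) :
    (f * (p - 1) + 1) ^ 5 < (p ^ f) ^ 4 := by
  obtain ⟨r, rfl⟩ : ∃ r, p = r + 1 := ⟨p - 1, by omega⟩
  rw [Nat.add_sub_cancel]
  induction f, hf using Nat.le_induction with
  | base =>
    rcases Nat.lt_or_ge r 3 with h | h
    · interval_cases r <;> norm_num at *
    · calc (2 * r + 1) ^ 5 < (2 * (r + 1)) ^ 5 := by gcongr; omega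
        _ = 32 * (r + 1) ^ 5 := by ring
        _ ≤ (r + 1) ^ 3 * (r + 1) ^ 5 := by
          gcongr
          calc 32 ≤ 4 ^ 3 := by norm_num
            _ ≤ (r + 1) ^ 3 := by gcongr; omega
        _ = ((r + 1) ^ 2) ^ 4 := by ring
  | succ f hf ih =>
    have h1 : 2 * ((f + 1) * r + 1) ≤ 3 * (f * r + 1) := by nlinarith
    have h2 : 2 ^ 5 * ((f + 1) * r + 1) ^ 5 ≤ 2 ^ 5 * (16 * (f * r + 1) ^ 5) := by
      calc 2 ^ 5 * ((f + 1) * r + 1) ^ 5 = (2 * ((f + 1) * r + 1)) ^ 5 := by ring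
        _ ≤ (3 * (f * r + 1)) ^ 5 := by gcongr
        _ = 243 * (f * r + 1) ^ 5 := by ring
        _ ≤ 2 ^ 5 * (16 * (f * r + 1) ^ 5) := by
          rw [← mul_assoc]
          gcongr
          norm_num
    calc ((f + 1) * r + 1) ^ 5 ≤ 16 * (f * r + 1) ^ 5 := Nat.le_of_mul_le_mul_left h2 (by norm_num)
      _ < 16 * ((r + 1) ^ f) ^ 4 := by gcongr
      _ = 2 ^ 4 * ((r + 1) ^ f) ^ 4 := by norm_num
      _ ≤ (r + 1) ^ 4 * ((r + 1) ^ f) ^ 4 := by gcongr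
      _ = ((r + 1) ^ (f + 1)) ^ 4 := by ring

theorem rpow_bounds_of_pow_lt {s β q D : ℕ} (hβ : 0 < β) (hs : 0 < s) (hsq : s ≤ q ^ 3)
    (hle : β * q ≤ s * D) (hD : D ^ 5 < q ^ 4) :
    (s : ℝ) ^ ((1 : ℝ) / 15) < (s : ℝ) / (β : ℝ) ∧ (β : ℝ) < (s : ℝ) ^ ((14 : ℝ) / 15) := by
  have h1 : (β ^ 15 * q ^ 3) * q ^ 12 < s ^ 15 * q ^ 12 := by
    calc (β ^ 15 * q ^ 3) * q ^ 12 = (β * q) ^ 15 := by ring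
      _ ≤ (s * D) ^ 15 := by gcongr
      _ = s ^ 15 * (D ^ 5) ^ 3 := by ring
      _ < s ^ 15 * (q ^ 4) ^ 3 := by gcongr
      _ = s ^ 15 * q ^ 12 := by ring
  have h2 : β ^ 15 * s < s ^ 15 :=
    (Nat.mul_le_mul_left _ hsq).trans_lt (Nat.lt_of_mul_lt_mul_right h1)
  have h3 : β ^ 15 < s ^ 14 := by
    rw [pow_succ s 14] at h2
    exact Nat.lt_of_mul_lt_mul_right h2
  have hβ' : (0 : ℝ) < β := by exact_mod_cast hβ
  have root : ∀ x : ℝ, 0 ≤ x → (x ^ 15) ^ ((1 : ℝ) / 15) = x := fun x hx => by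
    simpa using Real.pow_rpow_inv_natCast hx (n := 15) (by norm_num)
  constructor
  · rw [← root ((s : ℝ) / β) (by positivity)]
    refine Real.rpow_lt_rpow (by positivity) ?_ (by norm_num)
    rw [div_pow, lt_div_iff₀ (by positivity), mul_comm]
    exact_mod_cast h2
  · calc (β : ℝ) = ((β : ℝ) ^ 15) ^ ((1 : ℝ) / 15) := (root β hβ'.le).symm
      _ < ((s : ℝ) ^ 14) ^ ((1 : ℝ) / 15) :=
        Real.rpow_lt_rpow (by positivity) (by exact_mod_cast h3) (by norm_num)
      _ = (s : ℝ) ^ ((14 : ℝ) / 15) := by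
        rw [← Real.rpow_natCast, ← Real.rpow_mul (by positivity)]
        norm_num

/-- **Bound for `PSL(2,q)`, `q = p^f`, `f ≥ 2`.**  For `S = PSL(2, q)` with
`q = p^f` a proper prime power (`f ≥ 2`) we have `n(S) > |S|^(1/15)`, i.e.
`β(S) < |S|^(14/15)`. -/
theorem noetherNumber_PSL_two_prime_power
    (p f : ℕ) [Fact p.Prime] (hf : 2 ≤ f) :
    (Nat.card (Matrix.ProjectiveSpecialLinearGroup (Fin 2) (GaloisField p f)) : ℝ) ^
        ((1 : ℝ) / 15) <
      noetherIndex (Matrix.ProjectiveSpecialLinearGroup (Fin 2) (GaloisField p f)) ∧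
    (noetherNumber (Matrix.ProjectiveSpecialLinearGroup (Fin 2) (GaloisField p f)) : ℝ) <
      (Nat.card (Matrix.ProjectiveSpecialLinearGroup (Fin 2) (GaloisField p f)) : ℝ) ^
        ((14 : ℝ) / 15) := by
  have hf0 : f ≠ 0 := by omega
  have : Finite (Matrix.ProjectiveSpecialLinearGroup (Fin 2) (GaloisField p f)) :=
    Quotient.finite _
  have hq : Nat.card (GaloisField p f) = p ^ f := GaloisField.card p f hf0
  have hcard : Nat.card (Matrix.ProjectiveSpecialLinearGroup (Fin 2) (GaloisField p f)) ≤
      (p ^ f) ^ 3 := by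
    rw [← hq]
    exact (Nat.card_le_card_of_surjective _ Quotient.mk''_surjective).trans
      (Matrix.SpecialLinearGroup.card_fin_two_le _)
  obtain ⟨hpos, hle⟩ := noetherNumber_bounds_of_injective (p := p) _
    (Matrix.ProjectiveSpecialLinearGroup.upperUnipotent_injective (GaloisField p f))
  have hS : 0 < Nat.card (Matrix.ProjectiveSpecialLinearGroup (Fin 2) (GaloisField p f)) :=
    Nat.card_pos
  rw [hq, GaloisField.finrank p hf0] at hle
  have hnum := pow_five_lt_pow_four_mul (Fact.out : p.Prime).two_le hf
  exact rpow_bounds_of_pow_lt hpos hS hcard hle hnum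
end

section
/- Let p be a prime and h a positive integer, and let S be a finite multiset of elements of Z/pZ such that every element of Z/pZ occurs in S with multiplicity at most h. If |S| ≥ p, then S has a nonempty zero-sum submultiset T ⊆ S (i.e., the sum of the elements of T is 0 in Z/pZ) with |T| ≤ h. -/
/-- Removing one copy of each element lowers every multiplicity bound by one. -/
theorem Multiset.count_sub_dedup_le {α : Type*} [DecidableEq α] {S : Multiset α} {k : ℕ}
    (hcount : ∀ x, S.count x ≤ k + 1) (x : α) : (S - S.dedup).count x ≤ k := by
  have := hcount x
  rw [Multiset.count_sub, Multiset.count_dedup]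
  split_ifs with hx
  · omega
  · simp [Multiset.count_eq_zero_of_notMem hx]

theorem Multiset.singleton_add_le_of_le_sub_dedup {α : Type*} [DecidableEq α] {S T : Multiset α}
    {a : α} (ha : a ∈ S) (hT : T ≤ S - S.dedup) : {a} + T ≤ S :=
  calc {a} + T ≤ S.dedup + (S - S.dedup) := add_le_add (by simpa using ha) hT
    _ = S := add_tsub_cancel_of_le (Multiset.dedup_le S)

open scoped Pointwise

/-- If `0 ∉ S` and all multiplicities in `S` are at most `k`, then by Cauchy-Davenport the sums of
submultisets of `S` with at most `k` elements fill at least `min p (|S| + 1)` residues. -/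
theorem exists_finset_submultiset_sums {p : ℕ} (hp : p.Prime) (k : ℕ) (S : Multiset (ZMod p))
    (h0 : (0 : ZMod p) ∉ S) (hcount : ∀ x, S.count x ≤ k) :
    ∃ B : Finset (ZMod p), min p (Multiset.card S + 1) ≤ B.card ∧
      ∀ b ∈ B, ∃ T ≤ S, Multiset.card T ≤ k ∧ T.sum = b := by
  induction k generalizing S with
  | zero =>
    obtain rfl : S = 0 := Multiset.ext' fun x => by simpa using hcount x
    exact ⟨{0}, by simp, by simp⟩
  | succ k ih =>
    obtain ⟨B, hB, hT⟩ := ih (S - S.dedup)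
      (fun h => h0 (Multiset.mem_of_le (Multiset.sub_le_self _ _) h))
      (Multiset.count_sub_dedup_le hcount)
    have hcard := Multiset.card_sub (Multiset.dedup_le S)
    have hle := Multiset.card_le_card (Multiset.dedup_le S)
    have hB0 : B.Nonempty := Finset.card_pos.1 (by have := hp.pos; omega)
    refine ⟨insert 0 S.toFinset + B, ?_, ?_⟩
    · have hcd := ZMod.cauchy_davenport hp (Finset.insert_nonempty 0 S.toFinset) hB0
      rw [Finset.card_insert_of_notMem (by simpa using h0), Multiset.card_toFinset] at hcd
      omega
    · intro b hb
      obtain ⟨a, ha, c, hc, rfl⟩ := Finset.mem_add.1 hb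
      obtain ⟨T, hTS, hTk, rfl⟩ := hT c hc
      rcases Finset.mem_insert.1 ha with rfl | ha
      · exact ⟨T, hTS.trans (Multiset.sub_le_self _ _), by omega, by simp⟩
      · exact ⟨{a} + T, Multiset.singleton_add_le_of_le_sub_dedup (by simpa using ha) hTS,
          by simp; omega, by simp⟩

/-- **Lemma (zero-sum subsequences).**  Let `S` be a finite multiset over `Z/pZ`
(for `p` prime) with all multiplicities at most `h > 0`.  If `|S| ≥ p` then `S`
has a nonempty zero-sum submultiset `T` with `|T| ≤ h`. -/
theorem exists_zero_sum_submultiset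
    (p : ℕ) (hp : p.Prime) (h : ℕ) (hh : 0 < h)
    (S : Multiset (ZMod p)) (hcount : ∀ x : ZMod p, S.count x ≤ h)
    (hcard : p ≤ Multiset.card S) :
    ∃ T : Multiset (ZMod p), T ≤ S ∧ T ≠ 0 ∧ Multiset.card T ≤ h ∧ T.sum = 0 := by
  obtain ⟨k, rfl⟩ := Nat.exists_eq_add_of_lt hh
  by_cases h0 : (0 : ZMod p) ∈ S
  · exact ⟨{0}, by simpa using h0, by simp, by simp, by simp⟩
  obtain ⟨B, hB, hT⟩ := exists_finset_submultiset_sums hp k (S - S.dedup)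
    (fun h => h0 (Multiset.mem_of_le (Multiset.sub_le_self _ _) h))
    (Multiset.count_sub_dedup_le (by simpa using hcount))
  have hsub := Multiset.card_sub (Multiset.dedup_le S)
  have hle := Multiset.card_le_card (Multiset.dedup_le S)
  have hpos := hp.pos
  have : NeZero p := ⟨hp.ne_zero⟩
  have hB0 : B.Nonempty := Finset.card_pos.1 (by omega)
  have hS0 : S.toFinset.Nonempty := by
    rw [Multiset.toFinset_nonempty]
    rintro rfl
    simp at hcard
    omega
  have hcd := ZMod.cauchy_davenport hp hS0 hB0
  have hdedup := hS0.card_pos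
  rw [Multiset.card_toFinset] at hcd hdedup
  have huniv : S.toFinset + B = Finset.univ :=
    Finset.eq_univ_of_card _ (le_antisymm (Finset.card_le_univ _) (by rw [ZMod.card]; omega))
  obtain ⟨a, ha, c, hc, hac⟩ := Finset.mem_add.1 (huniv ▸ Finset.mem_univ (0 : ZMod p))
  obtain ⟨T, hTS, hTk, rfl⟩ := hT c hc
  exact ⟨{a} + T, Multiset.singleton_add_le_of_le_sub_dedup (by simpa using ha) hTS,
    by simp, by simp; omega, by simpa using hac⟩
end
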